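/- Let K be a field of characteristic p, and let f ∈ K[T,X] be an absolutely irreducible polynomial of total degree d ≥ 2 such that p does not divide d(d − 1) and the projective plane curve defined by the homogenization of f is smooth. Let A and B be two independent variables and regard f(T, A·T + B) as a polynomial in T over the rational function field K(A,B). Then the Galois group of the splitting field of f(T, A·T + B) over K(A,B) is isomorphic to the full symmetric group S_d. -/

import Mathlib

open MvPolynomial

/-- `f ∈ K[T,X]` is absolutely irreducible: it is irreducible over an algebraic
closure of `K`. -/
def AbsolutelyIrreducible {K : Type*} [Field K] (f : MvPolynomial (Fin 2) K) : Prop :=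
  Irreducible (MvPolynomial.map (algebraMap K (AlgebraicClosure K)) f)

/-- `F ∈ K[X₀,X₁,X₂]` is the degree-`d` homogenization of `f ∈ K[T,X]`
(so `F` is homogeneous of degree `d` with `F(1,T,X) = f(T,X)`) and the projective
plane curve `F = 0` is smooth: `F` and its three partial derivatives have no common
zero `≠ (0,0,0)` with coordinates in an algebraic closure of `K`. -/
def IsSmoothHomogenization {K : Type*} [Field K] (F : MvPolynomial (Fin 3) K)
    (f : MvPolynomial (Fin 2) K) (d : ℕ) : Prop :=
  F.IsHomogeneous d ∧
  MvPolynomial.aeval ![1, MvPolynomial.X 0, MvPolynomial.X 1] F = f ∧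
  ∀ x : Fin 3 → AlgebraicClosure K, x ≠ 0 →
    MvPolynomial.eval x (F.map (algebraMap K (AlgebraicClosure K))) = 0 →
    ∃ j : Fin 3, MvPolynomial.eval x ((MvPolynomial.pderiv j F).map
      (algebraMap K (AlgebraicClosure K))) ≠ 0

/-- `f(T, A·T + B)`, regarded as a polynomial in `T` over the rational function field
`K(A,B) = Frac(K[A,B])` (the substitution `X := A·T + B` applied to `f ∈ K[T,X]`,
where variable `0` of `f` is `T` and variable `1` is `X`). -/
noncomputable def lineSubAB {K : Type*} [Field K] (f : MvPolynomial (Fin 2) K) :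
    Polynomial (FractionRing (MvPolynomial (Fin 2) K)) :=
  MvPolynomial.aeval
    ![Polynomial.X,
      Polynomial.C (algebraMap (MvPolynomial (Fin 2) K)
          (FractionRing (MvPolynomial (Fin 2) K)) (MvPolynomial.X 0)) * Polynomial.X +
        Polynomial.C (algebraMap (MvPolynomial (Fin 2) K)
          (FractionRing (MvPolynomial (Fin 2) K)) (MvPolynomial.X 1))] f

namespace GalLine

/-- Chain rule. -/
lemma deriv_aeval {K B M σ : Type*} [Fintype σ] [CommRing K] [CommRing B] [Algebra K B]
    [AddCommGroup M] [Module K M] [Module B M] [IsScalarTower K B M]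
    (D : Derivation K B M) (x : σ → B) (p : MvPolynomial σ K) :
    D (aeval x p) = ∑ i, aeval x (pderiv i p) • D (x i) := by
  classical
  induction p using MvPolynomial.induction_on with
  | C a => simp
  | add p q hp hq => simp [hp, hq, add_smul, Finset.sum_add_distrib]
  | mul_X p n hp =>
    simp only [map_mul, aeval_X, Derivation.leibniz, hp, map_add, smul_eq_mul, add_smul,
      Finset.sum_add_distrib, pderiv_X, Finset.smul_sum]
    congr 1
    · rw [Finset.sum_eq_single n]
      · simp
      · intro b _ hb
        rw [Pi.single_eq_of_ne' hb]
        simp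
      · simp
    · simp [mul_smul]

/-- Scaling of homogeneous polynomials. -/
lemma hom_scale {K B σ : Type*} [CommRing K] [CommRing B] [Algebra K B] {G : MvPolynomial σ K}
    {m : ℕ} (hG : G.IsHomogeneous m) (c : B) (x : σ → B) :
    aeval (fun i => c * x i) G = c ^ m * aeval x G := by
  classical
  rw [aeval_def, aeval_def, eval₂_eq, eval₂_eq, Finset.mul_sum]
  refine Finset.sum_congr rfl fun s hs => ?_
  have h := hG.degree_eq_sum_deg_support hs
  simp_rw [mul_pow, Finset.prod_mul_distrib, Finset.prod_pow_eq_pow_sum]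
  rw [h]
  ring

/-- Dehomogenization. -/
noncomputable def dh (K : Type*) [Field K] :
    MvPolynomial (Fin 3) K →ₐ[K] MvPolynomial (Fin 2) K :=
  aeval ![1, X 0, X 1]

lemma aeval_dh {K B : Type*} [Field K] [CommRing B] [Algebra K B] (y : Fin 2 → B)
    (G : MvPolynomial (Fin 3) K) : aeval y (dh K G) = aeval ![1, y 0, y 1] G := by
  have : (aeval y).comp (dh K) = aeval (R := K) ![1, y 0, y 1] := by
    ext i; fin_cases i <;> simp [dh]
  exact DFunLike.congr_fun this G

lemma hom_eq_dh {K B : Type*} [Field K] [Field B] [Algebra K B] {G : MvPolynomial (Fin 3) K}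
    {m : ℕ} (hG : G.IsHomogeneous m) (x : Fin 3 → B) (hx : x 0 ≠ 0) :
    aeval x G = x 0 ^ m * aeval ![x 1 / x 0, x 2 / x 0] (dh K G) := by
  rw [aeval_dh, ← hom_scale hG]
  congr 2
  funext i
  fin_cases i <;> simp <;> field_simp

lemma dh_inj {K : Type*} [Field K] [Infinite K] {G : MvPolynomial (Fin 3) K}
    {m : ℕ} (hG : G.IsHomogeneous m) (h : dh K G = 0) : G = 0 := by
  have : X 0 * G = 0 := by
    apply MvPolynomial.funext
    intro x
    by_cases hx : x 0 = 0
    · simp [hx]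
    · have := hom_eq_dh hG x hx
      rw [h] at this
      simp only [map_zero, mul_zero] at this
      rw [map_mul, map_zero, ← MvPolynomial.coe_aeval_eq_eval]
      simp only [RingHom.coe_coe]
      rw [this, mul_zero]
  simpa using this

lemma dh_pderiv {K : Type*} [Field K] (G : MvPolynomial (Fin 3) K) (i : Fin 2) :
    pderiv i (dh K G) = dh K (pderiv i.succ G) := by
  rw [dh, deriv_aeval, Fin.sum_univ_three]
  fin_cases i <;> simp [pderiv_X]

lemma totalDegree_dh {K : Type*} [Field K] (G : MvPolynomial (Fin 3) K) :
    (dh K G).totalDegree ≤ G.totalDegree := by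
  classical
  rw [dh, aeval_def, eval₂_eq']
  refine totalDegree_finsetSum_le fun s hs => ?_
  refine (totalDegree_mul _ _).trans ?_
  rw [algebraMap_eq, totalDegree_C, zero_add, Fin.prod_univ_three]
  have h1 : s.degree ≤ G.totalDegree := by
    have := le_totalDegree hs
    simpa [Finsupp.degree_eq_sum, Finsupp.sum_fintype] using this
  refine le_trans ?_ h1
  simp only [Matrix.cons_val_zero, one_pow, one_mul, Matrix.cons_val_one, Matrix.cons_val]
  refine (totalDegree_mul _ _).trans ?_
  rw [totalDegree_X_pow, totalDegree_X_pow, Finsupp.degree_eq_sum, Fin.sum_univ_three]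
  omega

lemma exists_hom {K : Type*} [Field K] (w : MvPolynomial (Fin 2) K) (e : ℕ)
    (he : w.totalDegree ≤ e) : ∃ W : MvPolynomial (Fin 3) K, W.IsHomogeneous e ∧ dh K W = w := by
  classical
  refine ⟨∑ s ∈ w.support, C (coeff s w) * (X 0 ^ (e - s.degree) * X 1 ^ (s 0) * X 2 ^ (s 1)),
    ?_, ?_⟩
  · refine IsHomogeneous.sum _ _ _ fun s hs => ?_
    have h1 : s.degree ≤ e := by
      refine le_trans ?_ he
      have := le_totalDegree hs
      simpa [Finsupp.degree_eq_sum, Finsupp.sum_fintype] using this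
    have h2 : s.degree = s 0 + s 1 := by
      rw [Finsupp.degree_eq_sum, Fin.sum_univ_two]
    have := (((isHomogeneous_X_pow (R := K) (0 : Fin 3) (e - s.degree)).mul
      (isHomogeneous_X_pow (1 : Fin 3) (s 0))).mul (isHomogeneous_X_pow (2 : Fin 3) (s 1))).C_mul
        (coeff s w)
    convert! this using 1
    omega
  · rw [map_sum]
    conv_rhs => rw [w.as_sum]
    refine Finset.sum_congr rfl fun s hs => ?_
    simp only [dh, map_mul, map_pow, aeval_X, algHom_C, algebraMap_eq, Matrix.cons_val_zero,
      one_pow, one_mul, Matrix.cons_val_one, Matrix.cons_val]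
    rw [monomial_eq, Finsupp.prod_fintype _ _ (by simp), Fin.prod_univ_two]

lemma deh_dvd {K : Type*} [Field K] [Infinite K] {F G : MvPolynomial (Fin 3) K} {d m : ℕ}
    (hF : F.IsHomogeneous d) (hdeg : (dh K F).totalDegree = d) (hF0 : dh K F ≠ 0)
    (hG : G.IsHomogeneous m) (h : dh K F ∣ dh K G) : F ∣ G := by
  obtain ⟨w, hw⟩ := h
  by_cases hw0 : w = 0
  · rw [hw0, mul_zero] at hw
    rw [dh_inj hG hw]; exact dvd_zero _
  obtain ⟨W, hW, hWw⟩ := exists_hom w _ le_rfl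
  have h1 : d + w.totalDegree ≤ m := by
    rw [← hdeg, ← totalDegree_mul_of_isDomain hF0 hw0, ← hw]
    exact (totalDegree_dh G).trans hG.totalDegree_le
  have h2 : (X 0 ^ (m - (d + w.totalDegree)) * (F * W) - G).IsHomogeneous m := by
    refine IsHomogeneous.sub ?_ hG
    have := (isHomogeneous_X_pow (R := K) (0 : Fin 3) (m - (d + w.totalDegree))).mul (hF.mul hW)
    convert! this using 1
    omega
  have h3 := dh_inj h2 (by
    have : dh K (X 0) = 1 := by simp [dh]
    rw [map_sub, map_mul, map_mul, map_pow, this, hw, hWw]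
    simp)
  rw [sub_eq_zero] at h3
  rw [← h3]
  exact ⟨X 0 ^ (m - (d + w.totalDegree)) * W, by ring⟩

lemma F_prime {K : Type*} [Field K] [Infinite K] {F : MvPolynomial (Fin 3) K} {d : ℕ}
    (hF : F.IsHomogeneous d) (hdeg : (dh K F).totalDegree = d) (hirr : Irreducible (dh K F)) :
    Prime F := by
  have hF0 : F ≠ 0 := by
    rintro rfl
    exact hirr.ne_zero (map_zero _)
  rw [← Ideal.span_singleton_prime hF0]
  let : GradedAlgebra (homogeneousSubmodule (Fin 3) K) := gradedAlgebra
  refine Ideal.IsHomogeneous.isPrime_of_homogeneous_mem_or_mem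
    (𝒜 := homogeneousSubmodule (Fin 3) K) ?_ ?_ ?_
  · apply Ideal.homogeneous_span
    rintro x rfl
    exact ⟨d, hF⟩
  · rw [Ne, Ideal.span_singleton_eq_top]
    intro hu
    exact hirr.not_isUnit (hu.map (dh K))
  · rintro x y ⟨i, hx⟩ ⟨j, hy⟩ hxy
    rw [Ideal.mem_span_singleton] at hxy ⊢
    rw [Ideal.mem_span_singleton]
    have := map_dvd (dh K) hxy
    rw [map_mul] at this
    rcases hirr.prime.dvd_or_dvd this with h | h
    · exact Or.inl (deh_dvd hF hdeg hirr.ne_zero hx h)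
    · exact Or.inr (deh_dvd hF hdeg hirr.ne_zero hy h)

end GalLine

namespace GalLine

lemma exists_lam {K : Type*} [Field K] [Infinite K] {F : MvPolynomial (Fin 3) K} {d : ℕ}
    (hF : F.IsHomogeneous d) (hdeg : (dh K F).totalDegree = d) (hirr : Irreducible (dh K F))
    (hd : 1 ≤ d) : ∃ l : K, eval ![0, l, 1] F ≠ 0 := by
  by_contra! hcon
  set π : MvPolynomial (Fin 3) K →ₐ[K] MvPolynomial (Fin 3) K := aeval ![0, X 1, X 2] with hπ
  have hev : ∀ (x : Fin 3 → K) (G), eval x (π G) = eval ![0, x 1, x 2] G := by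
    intro x G
    have : (aeval x).comp π = aeval (R := K) ![0, x 1, x 2] := by
      ext i; fin_cases i <;> simp [π]
    exact DFunLike.congr_fun this G
  have h1 : X 2 * π F = 0 := by
    apply MvPolynomial.funext
    intro x
    rw [map_mul, map_zero, hev, eval_X]
    by_cases hx : x 2 = 0
    · rw [hx, zero_mul]
    · have h2 := hom_scale hF (x 2) ![0, x 1 / x 2, 1]
      have h3 : (fun i => x 2 * (![0, x 1 / x 2, 1] : Fin 3 → K) i) = ![0, x 1, x 2] := by
        funext i; fin_cases i <;> simp; field_simp
      rw [h3] at h2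
      have h4 : eval ![0, x 1, x 2] F = x 2 ^ d * eval ![0, x 1 / x 2, 1] F := h2
      rw [h4, hcon]; simp
  have h2 : π F = 0 := by simpa using h1
  have h3 : X 0 ∣ F := by
    have key : ∀ G : MvPolynomial (Fin 3) K, X 0 ∣ G - π G := by
      intro G
      induction G using MvPolynomial.induction_on with
      | C a => simp [π]
      | add p q hp hq =>
        have := dvd_add hp hq
        rw [map_add]; convert this using 1; ring
      | mul_X p i hp =>
        rw [map_mul]
        have h5 : X 0 ∣ (X i : MvPolynomial (Fin 3) K) - π (X i) := by
          fin_cases i <;> simp [π]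
        have := dvd_add (hp.mul_right (X i)) (h5.mul_left (π p))
        convert this using 1; ring
    simpa [h2] using key F
  obtain ⟨G, rfl⟩ := h3
  have h4 : dh K (X 0 * G) = dh K G := by simp [dh]
  have hG0 : G ≠ 0 := by
    rintro rfl; simp at hirr
  have h5 := totalDegree_dh G
  have h6 := hF.totalDegree_le
  rw [totalDegree_mul_of_isDomain (X_ne_zero _) hG0, totalDegree_X] at h6
  rw [h4] at hdeg
  omega

lemma dvd_sub_pi {K : Type*} [Field K] (G : MvPolynomial (Fin 3) K) :
    X 0 ∣ G - (aeval ![0, X 1, X 2] G : MvPolynomial (Fin 3) K) := by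
  induction G using MvPolynomial.induction_on with
  | C a => simp
  | add p q hp hq =>
    have := dvd_add hp hq
    rw [map_add]; convert this using 1; ring
  | mul_X p i hp =>
    rw [map_mul]
    have h5 : X 0 ∣ (X i : MvPolynomial (Fin 3) K) - (aeval ![0, X 1, X 2] (X i : MvPolynomial (Fin 3) K) : MvPolynomial (Fin 3) K) := by
      fin_cases i <;> simp
    have := dvd_add (hp.mul_right (X i)) (h5.mul_left (aeval ![0, X 1, X 2] p : MvPolynomial (Fin 3) K))
    convert this using 1; ring

/-- `X₀` and a suitable linear form is a regular sequence modulo `F`. -/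
lemma regular_step {K : Type*} [Field K] {F : MvPolynomial (Fin 3) K} (l : K)
    (hl : eval ![0, l, 1] F ≠ 0) (N n : ℕ) (u v : MvPolynomial (Fin 3) K)
    (h : F ∣ (X 1 - C l * X 2) ^ N * u - X 0 ^ (n + 1) * v) :
    ∃ u' w, u = X 0 * u' + F * w := by
  set π : MvPolynomial (Fin 3) K →ₐ[K] MvPolynomial (Fin 3) K := aeval ![0, X 1, X 2] with hπ
  set L : MvPolynomial (Fin 3) K := X 1 - C l * X 2 with hL
  have h1 := map_dvd π h
  have hLπ : π L = L := by simp [π, L]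
  rw [map_sub, map_mul, map_mul, map_pow, map_pow, hLπ] at h1
  have hX0 : π (X 0) = 0 := by simp [π]
  rw [hX0, zero_pow (by omega), zero_mul, sub_zero] at h1
  have hLirr : Irreducible L := by
    have hdeg : L.totalDegree = 1 := by
      have hom : L.IsHomogeneous 1 :=
        (isHomogeneous_X _ _).sub (isHomogeneous_C_mul_X _ _)
      refine hom.totalDegree ?_
      intro h0
      have := congrArg (eval ![0, 1, 0]) h0
      simp [L] at this
    apply irreducible_of_totalDegree_eq_one hdeg
    intro x hx
    have := hx (Finsupp.single 1 1)
    have h21 : coeff (Finsupp.single 1 1) (X 2 : MvPolynomial (Fin 3) K) = 0 := by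
      rw [X, coeff_monomial, if_neg]
      intro h
      have := DFunLike.congr_fun h 1
      simp at this
    have h11 : coeff (Finsupp.single 1 1) (X 1 : MvPolynomial (Fin 3) K) = 1 := by
      rw [X, coeff_monomial, if_pos rfl]
    rw [hL, coeff_sub, coeff_C_mul, h21, h11] at this
    rw [isUnit_iff_dvd_one]
    simpa using this
  have hnd : ¬ L ∣ π F := by
    rintro ⟨q, hq⟩
    have h2 := congrArg (eval ![0, l, 1]) hq
    have h3 : eval ![0, l, 1] (π F) = eval ![0, l, 1] F := by
      have : (aeval ![0, l, 1]).comp π = aeval (R := K) ![0, l, 1] := by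
        ext i; fin_cases i <;> simp [π]
      exact DFunLike.congr_fun this F
    rw [h3] at h2
    apply hl
    rw [h2]
    simp [L]
  have hrel : IsRelPrime (π F) (L ^ N) :=
    ((hLirr.isRelPrime_iff_not_dvd.mpr hnd).pow_left).symm
  have h2 : π F ∣ π u := hrel.dvd_of_dvd_mul_left h1
  obtain ⟨w, hw⟩ := h2
  obtain ⟨a, ha⟩ := dvd_sub_pi u
  obtain ⟨b, hb⟩ := dvd_sub_pi F
  refine ⟨a - b * w, w, ?_⟩
  linear_combination ha + hw - w * hb

lemma depth_lemma {K : Type*} [Field K] [IsAlgClosed K] {F : MvPolynomial (Fin 3) K} {d : ℕ}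
    (hF : F.IsHomogeneous d) (hdeg : (dh K F).totalDegree = d) (hirr : Irreducible (dh K F))
    (hd : 2 ≤ d)
    (hsm : ∀ x : Fin 3 → K, x ≠ 0 → eval x F = 0 → ∃ j, eval x (pderiv j F) ≠ 0)
    (hk : ∃ k, ¬ F ∣ pderiv k F)
    (e : Fin 3 → MvPolynomial (Fin 3) K)
    (he : ∀ k l, F ∣ e k * pderiv l F - e l * pderiv k F) :
    ∃ c, ∀ k, F ∣ e k - c * pderiv k F := by
  have : Infinite K := IsAlgClosed.instInfinite
  have hpr := F_prime hF hdeg hirr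
  obtain ⟨l, hl⟩ := exists_lam hF hdeg hirr (by omega)
  obtain ⟨k0, hk0⟩ := hk
  have hX0 : ¬ F ∣ X 0 := by
    rintro ⟨q, hq⟩
    have hq0 : q ≠ 0 := by
      rintro rfl
      simp at hq
    have h1 := totalDegree_mul_of_isDomain hpr.ne_zero hq0
    rw [← hq, totalDegree_X, hF.totalDegree hpr.ne_zero] at h1
    omega
  have hnull : ∀ y : MvPolynomial (Fin 3) K, eval 0 y = 0 →
      ∃ N u, ∀ k, F ∣ y ^ N * e k - u * pderiv k F := by
    intro y hy
    set I : Ideal (MvPolynomial (Fin 3) K) :=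
      Ideal.span {F, pderiv 0 F, pderiv 1 F, pderiv 2 F} with hI
    have hy' : y ∈ vanishingIdeal K (zeroLocus K I) := by
      rw [mem_vanishingIdeal_iff]
      intro x hx
      rw [mem_zeroLocus_iff] at hx
      by_cases hx0 : x = 0
      · rw [hx0]; exact hy
      · exfalso
        have hm : ∀ z ∈ ({F, pderiv 0 F, pderiv 1 F, pderiv 2 F} : Set _), eval x z = 0 :=
          fun z hz => hx z (Ideal.subset_span hz)
        obtain ⟨j, hj⟩ := hsm x hx0 (hm F (by simp))
        apply hj
        apply hm
        fin_cases j <;> simp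
    rw [vanishingIdeal_zeroLocus_eq_radical] at hy'
    obtain ⟨N, hN⟩ := hy'
    rw [hI, Ideal.mem_span_insert] at hN
    obtain ⟨a, z, hz, hN⟩ := hN
    rw [Ideal.mem_span_insert] at hz
    obtain ⟨a0, z, hz', rfl⟩ := hz
    rw [Ideal.mem_span_pair] at hz'
    obtain ⟨a1, a2, rfl⟩ := hz'
    refine ⟨N, a0 * e 0 + a1 * e 1 + a2 * e 2, fun k => ?_⟩
    obtain ⟨q0, h0⟩ := he k 0
    obtain ⟨q1, h1⟩ := he k 1
    obtain ⟨q2, h2⟩ := he k 2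
    refine ⟨a * e k + a0 * q0 + a1 * q1 + a2 * q2, ?_⟩
    rw [hN]
    linear_combination a0 * h0 + a1 * h1 + a2 * h2
  obtain ⟨N, v, hv⟩ := hnull (X 1 - C l * X 2) (by simp)
  obtain ⟨n, u, hu⟩ := hnull (X 0) (by simp)
  have main : ∀ n : ℕ, ∀ u, (∀ k, F ∣ X 0 ^ n * e k - u * pderiv k F) →
      ∃ c, ∀ k, F ∣ e k - c * pderiv k F := by
    intro n
    induction n with
    | zero => intro u hu; exact ⟨u, fun k => by simpa using hu k⟩
    | succ n ih =>
      intro u hu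
      have h1 : F ∣ ((X 1 - C l * X 2) ^ N * u - X 0 ^ (n + 1) * v) * pderiv k0 F := by
        have := dvd_sub ((hv k0).mul_left (X 0 ^ (n + 1))) ((hu k0).mul_left
          ((X 1 - C l * X 2) ^ N))
        convert this using 1; ring
      have h2 := (hpr.dvd_or_dvd h1).resolve_right hk0
      obtain ⟨u', w, huw⟩ := regular_step l hl N n u v h2
      apply ih u'
      intro k
      have h3 : F ∣ X 0 * (X 0 ^ n * e k - u' * pderiv k F) := by
        have := dvd_add (hu k) (dvd_mul_right F (w * pderiv k F))
        convert this using 1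
        rw [huw]; ring
      exact (hpr.dvd_or_dvd h3).resolve_left hX0
  exact main n u hu

/-- The Hessian expression. -/
noncomputable def hess {K : Type*} [Field K] (F : MvPolynomial (Fin 3) K) :
    MvPolynomial (Fin 3) K :=
  pderiv 1 (pderiv 1 F) * pderiv 2 F ^ 2 - 2 * pderiv 1 (pderiv 2 F) * pderiv 1 F * pderiv 2 F
    + pderiv 2 (pderiv 2 F) * pderiv 1 F ^ 2

lemma pderiv_comm' {K σ : Type*} [Field K] (F : MvPolynomial σ K) (i j : σ) :
    pderiv i (pderiv j F) = pderiv j (pderiv i F) := by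
  classical
  induction F using MvPolynomial.induction_on with
  | C a => simp
  | add p q hp hq => simp [hp, hq]
  | mul_X p n hp =>
    have h : ∀ a b : σ, pderiv a (Pi.single (M := fun _ => MvPolynomial σ K) b 1 n) = 0 := by
      intro a b
      by_cases hb : n = b
      · subst hb; simp
      · rw [Pi.single_eq_of_ne hb]; simp
    simp only [pderiv_mul, map_add, hp, pderiv_X, h]
    ring

/-- Algebraic identities for row vectors. -/
lemma row_dvd {R : Type*} [CommRing R] {F x0 x1 x2 n0 n1 n2 H00 H01 H02 H11 H12 H22 d D r : R}
    (cancel : ∀ z, F ∣ x0 * z → F ∣ z)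
    (hE0 : x0 * n0 + x1 * n1 + x2 * n2 = d * F)
    (h0 : x0 * H00 + x1 * H01 + x2 * H02 = D * n0)
    (h1 : x0 * H01 + x1 * H11 + x2 * H12 = D * n1)
    (h2 : x0 * H02 + x1 * H12 + x2 * H22 = D * n2)
    (hr : H11 * n2 ^ 2 - 2 * H12 * n1 * n2 + H22 * n1 ^ 2 = F * r) :
    ∀ m k l : Fin 3, F ∣
      (![![n1 * H02 - n2 * H01, n1 * H12 - n2 * H11, n1 * H22 - n2 * H12],
        ![n2 * H00 - n0 * H02, n2 * H01 - n0 * H12, n2 * H02 - n0 * H22],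
        ![n0 * H01 - n1 * H00, n0 * H11 - n1 * H01, n0 * H12 - n1 * H02]] :
          Fin 3 → Fin 3 → R) m k * ![n0, n1, n2] l -
      (![![n1 * H02 - n2 * H01, n1 * H12 - n2 * H11, n1 * H22 - n2 * H12],
        ![n2 * H00 - n0 * H02, n2 * H01 - n0 * H12, n2 * H02 - n0 * H22],
        ![n0 * H01 - n1 * H00, n0 * H11 - n1 * H01, n0 * H12 - n1 * H02]] :
          Fin 3 → Fin 3 → R) m l * ![n0, n1, n2] k := by
  have anti : ∀ (e n : Fin 3 → R), F ∣ e 0 * n 1 - e 1 * n 0 → F ∣ e 0 * n 2 - e 2 * n 0 →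
      F ∣ e 1 * n 2 - e 2 * n 1 → ∀ k l, F ∣ e k * n l - e l * n k := by
    intro e n a b c k l
    have a' := (dvd_neg.mpr a)
    have b' := (dvd_neg.mpr b)
    have c' := (dvd_neg.mpr c)
    rw [neg_sub] at a' b' c'
    fin_cases k <;> fin_cases l <;> first | assumption | simp
  have row0 : ∀ k l : Fin 3, F ∣
      (![n1 * H02 - n2 * H01, n1 * H12 - n2 * H11, n1 * H22 - n2 * H12] : Fin 3 → R) k *
        ![n0, n1, n2] l -
      (![n1 * H02 - n2 * H01, n1 * H12 - n2 * H11, n1 * H22 - n2 * H12] : Fin 3 → R) l *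
        ![n0, n1, n2] k := by
    have hP0 : x0 * (n1 * H02 - n2 * H01) + x1 * (n1 * H12 - n2 * H11) +
        x2 * (n1 * H22 - n2 * H12) = 0 := by
      linear_combination n1 * h2 - n2 * h1
    apply anti
    · apply cancel
      refine ⟨-x2 * r - d * (n1 * H12 - n2 * H11), ?_⟩
      simp only [Matrix.cons_val_zero, Matrix.cons_val_one, Matrix.cons_val]
      linear_combination n1 * hP0 - (n1 * H12 - n2 * H11) * hE0 - x2 * hr
    · apply cancel
      refine ⟨x1 * r - d * (n1 * H22 - n2 * H12), ?_⟩
      simp only [Matrix.cons_val_zero, Matrix.cons_val_one, Matrix.cons_val]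
      linear_combination n2 * hP0 - (n1 * H22 - n2 * H12) * hE0 + x1 * hr
    · refine ⟨- r, ?_⟩
      simp only [Matrix.cons_val_zero, Matrix.cons_val_one, Matrix.cons_val]
      linear_combination - hr
  have step : ∀ (e e' n v : Fin 3 → R) (y z : R), (∀ k, x0 * e' k = y * e k + z * n k + F * v k) →
      (∀ k l, F ∣ e k * n l - e l * n k) → ∀ k l, F ∣ e' k * n l - e' l * n k := by
    intro e e' n v y z h hh k l
    apply cancel
    obtain ⟨q, hq⟩ := hh k l
    exact ⟨y * q + v k * n l - v l * n k, by
      linear_combination n l * h k - n k * h l + y * hq⟩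
  intro m
  fin_cases m
  · exact row0
  · refine step _ _ _ ![-d * H02, -d * H12, -d * H22] x1 (n2 * D) (fun k => ?_) row0
    fin_cases k <;>
    simp only [Fin.zero_eta, Fin.mk_one, Fin.reduceFinMk, Matrix.cons_val_zero,
      Matrix.cons_val_one, Matrix.cons_val]
    · linear_combination n2 * h0 - H02 * hE0
    · linear_combination n2 * h1 - H12 * hE0
    · linear_combination n2 * h2 - H22 * hE0
  · refine step _ _ _ ![d * H01, d * H11, d * H12] x2 (-n1 * D) (fun k => ?_) row0
    fin_cases k <;>
    simp only [Fin.zero_eta, Fin.mk_one, Fin.reduceFinMk, Matrix.cons_val_zero,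
      Matrix.cons_val_one, Matrix.cons_val]
    · linear_combination -n1 * h0 + H01 * hE0
    · linear_combination -n1 * h1 + H11 * hE0
    · linear_combination -n1 * h2 + H12 * hE0

lemma hess_not_dvd {K : Type*} [Field K] [IsAlgClosed K] {F : MvPolynomial (Fin 3) K} {d : ℕ}
    (hF : F.IsHomogeneous d) (hdeg : (dh K F).totalDegree = d) (hirr : Irreducible (dh K F))
    (hd : 2 ≤ d) (hdK : (d : K) ≠ 0) (hdK' : ((d - 1 : ℕ) : K) ≠ 0)
    (hsm : ∀ x : Fin 3 → K, x ≠ 0 → eval x F = 0 → ∃ j, eval x (pderiv j F) ≠ 0) :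
    ¬ F ∣ hess F := by
  have : Infinite K := IsAlgClosed.instInfinite
  intro hcon
  have hpr := F_prime hF hdeg hirr
  have hE0 := hF.sum_X_mul_pderiv
  have hEk : ∀ k, _ := fun k => (hF.pderiv (i := k)).sum_X_mul_pderiv
  simp only [Fin.sum_univ_three, nsmul_eq_mul] at hE0 hEk
  have hdeg' : ∀ k, F ∣ pderiv k F → pderiv k F = 0 := by
    rintro k ⟨q, hq⟩
    by_contra hne
    have hq0 : q ≠ 0 := by rintro rfl; simp at hq; exact hne hq
    have h1 := totalDegree_mul_of_isDomain hpr.ne_zero hq0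
    rw [← hq, (hF.pderiv).totalDegree hne, hF.totalDegree hpr.ne_zero] at h1
    omega
  have hdC : (d : MvPolynomial (Fin 3) K) ≠ 0 := by
    rw [← map_natCast (C : K →+* MvPolynomial (Fin 3) K), Ne, C_eq_zero]; exact hdK
  have hk : ∃ k, ¬ F ∣ pderiv k F := by
    by_contra! h
    rw [hdeg' 0 (h 0), hdeg' 1 (h 1), hdeg' 2 (h 2)] at hE0
    simp only [mul_zero, add_zero] at hE0
    rcases mul_eq_zero.mp hE0.symm with h | h
    · exact hdC h
    · exact hpr.ne_zero h
  have hX0 : ¬ F ∣ X 0 := by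
    rintro ⟨q, hq⟩
    have hq0 : q ≠ 0 := by
      rintro rfl
      simp at hq
    have h1 := totalDegree_mul_of_isDomain hpr.ne_zero hq0
    rw [← hq, totalDegree_X, hF.totalDegree hpr.ne_zero] at h1
    omega
  have cancel : ∀ z, F ∣ X 0 * z → F ∣ z := fun z hz =>
    (hpr.dvd_or_dvd hz).resolve_left hX0
  set D : MvPolynomial (Fin 3) K := ((d - 1 : ℕ) : MvPolynomial (Fin 3) K) with hD
  -- names
  have h0 := hEk 0
  have h1 := hEk 1
  have h2 := hEk 2
  obtain ⟨r, hr⟩ := hcon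
  unfold hess at hr
  have s10 := pderiv_comm' F 1 0
  have s20 := pderiv_comm' F 2 0
  have s21 := pderiv_comm' F 2 1
  rw [s10, s20] at h0
  rw [s21] at h1
  set n0 := pderiv 0 F
  set n1 := pderiv 1 F
  set n2 := pderiv 2 F
  set H00 := pderiv 0 n0
  set H01 := pderiv 0 n1
  set H02 := pderiv 0 n2
  set H11 := pderiv 1 n1
  set H12 := pderiv 1 n2
  set H22 := pderiv 2 n2
  have hall : ∃ c : Fin 3 → MvPolynomial (Fin 3) K, ∀ m k, F ∣
      (![![n1 * H02 - n2 * H01, n1 * H12 - n2 * H11, n1 * H22 - n2 * H12],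
        ![n2 * H00 - n0 * H02, n2 * H01 - n0 * H12, n2 * H02 - n0 * H22],
        ![n0 * H01 - n1 * H00, n0 * H11 - n1 * H01, n0 * H12 - n1 * H02]] :
          Fin 3 → Fin 3 → MvPolynomial (Fin 3) K) m k - c m * pderiv k F := by
    have hrow := row_dvd cancel hE0 h0 h1 h2 hr
    have hn : ∀ k, (![n0, n1, n2] : Fin 3 → MvPolynomial (Fin 3) K) k = pderiv k F := by
      intro k; fin_cases k <;> rfl
    simp only [hn] at hrow
    choose c hc using fun m => depth_lemma hF hdeg hirr hd hsm hk _ (hrow m)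
    exact ⟨c, hc⟩
  obtain ⟨c, hc⟩ := hall
  obtain ⟨k, hk⟩ := hk
  have cancel2 : ∀ z, F ∣ z * pderiv k F → F ∣ z := fun z hz =>
    (hpr.dvd_or_dvd hz).resolve_right hk
  obtain ⟨q0, g0⟩ := hc 0 k
  obtain ⟨q1, g1⟩ := hc 1 k
  obtain ⟨q2, g2⟩ := hc 2 k
  have w0 : F ∣ X 1 * c 2 - X 2 * c 1 - D * n0 := by
    apply cancel2
    fin_cases k
    · refine ⟨-(d : MvPolynomial (Fin 3) K) * H00 - X 1 * q2 + X 2 * q1, ?_⟩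
      simp only [Fin.zero_eta, Fin.mk_one, Fin.reduceFinMk, Matrix.cons_val_zero,
        Matrix.cons_val_one, Matrix.cons_val] at g1 g2 ⊢
      linear_combination n0 * h0 - H00 * hE0 - X 1 * g2 + X 2 * g1
    · refine ⟨-(d : MvPolynomial (Fin 3) K) * H01 - X 1 * q2 + X 2 * q1, ?_⟩
      simp only [Fin.zero_eta, Fin.mk_one, Fin.reduceFinMk, Matrix.cons_val_zero,
        Matrix.cons_val_one, Matrix.cons_val] at g1 g2 ⊢
      linear_combination n0 * h1 - H01 * hE0 - X 1 * g2 + X 2 * g1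
    · refine ⟨-(d : MvPolynomial (Fin 3) K) * H02 - X 1 * q2 + X 2 * q1, ?_⟩
      simp only [Fin.zero_eta, Fin.mk_one, Fin.reduceFinMk, Matrix.cons_val_zero,
        Matrix.cons_val_one, Matrix.cons_val] at g1 g2 ⊢
      linear_combination n0 * h2 - H02 * hE0 - X 1 * g2 + X 2 * g1
  have w1 : F ∣ X 2 * c 0 - X 0 * c 2 - D * n1 := by
    apply cancel2
    fin_cases k
    · refine ⟨-(d : MvPolynomial (Fin 3) K) * H01 - X 2 * q0 + X 0 * q2, ?_⟩
      simp only [Fin.zero_eta, Fin.mk_one, Fin.reduceFinMk, Matrix.cons_val_zero,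
        Matrix.cons_val_one, Matrix.cons_val] at g0 g2 ⊢
      linear_combination n1 * h0 - H01 * hE0 - X 2 * g0 + X 0 * g2
    · refine ⟨-(d : MvPolynomial (Fin 3) K) * H11 - X 2 * q0 + X 0 * q2, ?_⟩
      simp only [Fin.zero_eta, Fin.mk_one, Fin.reduceFinMk, Matrix.cons_val_zero,
        Matrix.cons_val_one, Matrix.cons_val] at g0 g2 ⊢
      linear_combination n1 * h1 - H11 * hE0 - X 2 * g0 + X 0 * g2
    · refine ⟨-(d : MvPolynomial (Fin 3) K) * H12 - X 2 * q0 + X 0 * q2, ?_⟩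
      simp only [Fin.zero_eta, Fin.mk_one, Fin.reduceFinMk, Matrix.cons_val_zero,
        Matrix.cons_val_one, Matrix.cons_val] at g0 g2 ⊢
      linear_combination n1 * h2 - H12 * hE0 - X 2 * g0 + X 0 * g2
  have w2 : F ∣ X 0 * c 1 - X 1 * c 0 - D * n2 := by
    apply cancel2
    fin_cases k
    · refine ⟨-(d : MvPolynomial (Fin 3) K) * H02 - X 0 * q1 + X 1 * q0, ?_⟩
      simp only [Fin.zero_eta, Fin.mk_one, Fin.reduceFinMk, Matrix.cons_val_zero,
        Matrix.cons_val_one, Matrix.cons_val] at g0 g1 ⊢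
      linear_combination n2 * h0 - H02 * hE0 - X 0 * g1 + X 1 * g0
    · refine ⟨-(d : MvPolynomial (Fin 3) K) * H12 - X 0 * q1 + X 1 * q0, ?_⟩
      simp only [Fin.zero_eta, Fin.mk_one, Fin.reduceFinMk, Matrix.cons_val_zero,
        Matrix.cons_val_one, Matrix.cons_val] at g0 g1 ⊢
      linear_combination n2 * h1 - H12 * hE0 - X 0 * g1 + X 1 * g0
    · refine ⟨-(d : MvPolynomial (Fin 3) K) * H22 - X 0 * q1 + X 1 * q0, ?_⟩
      simp only [Fin.zero_eta, Fin.mk_one, Fin.reduceFinMk, Matrix.cons_val_zero,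
        Matrix.cons_val_one, Matrix.cons_val] at g0 g1 ⊢
      linear_combination n2 * h2 - H22 * hE0 - X 0 * g1 + X 1 * g0
  obtain ⟨v0, hv0⟩ := w0
  obtain ⟨v1, hv1⟩ := w1
  obtain ⟨v2, hv2⟩ := w2
  have hfin : F * (D * (d : MvPolynomial (Fin 3) K) + (X 0 * v0 + X 1 * v1 + X 2 * v2)) = 0 := by
    linear_combination - D * hE0 - X 0 * hv0 - X 1 * hv1 - X 2 * hv2
  have hfin2 := (mul_eq_zero.mp hfin).resolve_left hpr.ne_zero
  have hfin3 := congrArg (eval (0 : Fin 3 → K)) hfin2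
  simp only [hD, map_add, map_mul, map_natCast, eval_X, Pi.zero_apply, zero_mul, add_zero,
    map_zero] at hfin3
  rcases mul_eq_zero.mp hfin3 with h | h
  · exact hdK' h
  · exact hdK h

end GalLine

namespace GalLine

lemma inj_of_indep {K S E : Type*} [Field K] [CommRing S] [IsDomain S] [Algebra K S] [Field E]
    [Algebra K E] (n : ℕ) (htr : Algebra.trdeg K S ≤ n) (φ : S →ₐ[K] E) (y : Fin n → E)
    (hy : AlgebraicIndependent K y) (halg : ∀ i, IsAlgebraic φ.range (y i)) :
    Function.Injective φ := by
  classical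
  set R := φ.range with hR
  let E0 := Subalgebra.algebraicClosure R E
  have hE0 : Algebra.IsAlgebraic R E0 := inferInstance
  let y0 : Fin n → E0 := fun i => ⟨y i, halg i⟩
  have hy0 : AlgebraicIndependent K y0 := by
    apply AlgebraicIndependent.of_comp (E0.val.restrictScalars K)
    exact hy
  have hfs : FaithfulSMul R E0 := by
    rw [faithfulSMul_iff_algebraMap_injective]
    intro a b hab
    exact Subtype.ext (congrArg (fun w : E0 => (w : E)) hab)
  have h1 := trdeg_add_eq K R (A := E0)
  have h2 : Algebra.trdeg R E0 = 0 := trdeg_eq_zero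
  have h3 := hy0.lift_cardinalMk_le_trdeg
  rw [← h1, h2, add_zero] at h3
  obtain ⟨B, hB⟩ := exists_isTranscendenceBasis K R
  rw [← hB.cardinalMk_eq_trdeg] at h3
  obtain ⟨j⟩ := Cardinal.lift_mk_le'.mp h3
  have hw : AlgebraicIndependent K (fun i => ((j i : B) : R)) :=
    hB.1.comp j j.injective
  have hw' : AlgebraicIndependent K (fun i => ((j i : R) : E)) :=
    hw.map' (f := R.val) Subtype.val_injective
  choose z hz using fun i => (j i : R).2
  have hz1 : AlgebraicIndependent K (φ ∘ z) := by
    convert! hw' using 1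
    funext i
    exact hz i
  have hz2 : AlgebraicIndependent K z := AlgebraicIndependent.of_comp φ hz1
  have hz3 : IsTranscendenceBasis K z := by
    apply hz2.isTranscendenceBasis_of_lift_trdeg_le_of_finite
    have := Cardinal.lift_le.{0}.mpr htr
    simpa using this
  have halgS := hz3.isAlgebraic
  rw [injective_iff_map_eq_zero]
  intro s hs
  by_contra hs0
  obtain ⟨r, hr0, q, hq⟩ := (halgS.isAlgebraic s).exists_nonzero_dvd
    (mem_nonZeroDivisors_of_ne_zero hs0)
  apply hr0
  obtain ⟨r, hr⟩ := r
  have hr' := hr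
  rw [Algebra.adjoin_range_eq_range_aeval] at hr'
  obtain ⟨P, rfl⟩ := hr'
  have h5 : aeval (φ ∘ z) P = 0 := by
    have : aeval (φ ∘ z) P = φ (aeval z P) := by
      exact (MvPolynomial.comp_aeval_apply _ φ P).symm
    rw [this]
    change aeval z P = s * q at hq
    rw [hq, map_mul, hs, zero_mul]
  have hP : P = 0 := by
    apply hz1
    rw [h5, map_zero]
  ext
  simp [hP]

lemma tensor_domain {K A A' : Type*} [Field K] [IsAlgClosed K] [CommRing A] [IsDomain A]
    [Algebra K A] [CommRing A'] [IsDomain A'] [Algebra K A'] [Algebra.FiniteType K A] :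
    IsDomain (TensorProduct K A A') := by
  classical
  let c := Module.Basis.ofVectorSpace K A'
  let b := Algebra.TensorProduct.basis A c
  have hpt : ∀ (χ : A →ₐ[K] K) (u : TensorProduct K A A'),
      Algebra.TensorProduct.lift ((Algebra.ofId K A').comp χ) (AlgHom.id K A')
        (fun _ _ => Commute.all _ _) u = (b.repr u).sum (fun i a => χ a • c i) := by
    intro χ u
    conv_lhs => rw [← b.linearCombination_repr u]
    rw [Finsupp.linearCombination_apply, Finsupp.sum, map_sum]
    refine Finset.sum_congr rfl fun i _ => ?_
    rw [Algebra.TensorProduct.basis_apply, TensorProduct.smul_tmul']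
    simp [Algebra.ofId_apply, Algebra.smul_def]
  have hjac : ∀ a : A, (∀ χ : A →ₐ[K] K, χ a = 0) → a = 0 := by
    intro a ha
    have : a ∈ (⊥ : Ideal A).jacobson := by
      rw [Ideal.mem_jacobson_bot]
      intro y
      by_contra hu
      obtain ⟨m, hm, hmem⟩ := exists_max_ideal_of_mem_nonunits hu
      have := hm
      let : Field (A ⧸ m) := Ideal.Quotient.field m
      have : Algebra.FiniteType K (A ⧸ m) := inferInstance
      have hfin : Module.Finite K (A ⧸ m) := finite_of_finite_type_of_isJacobsonRing K (A ⧸ m)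
      have hbij := IsAlgClosed.algebraMap_bijective_of_isIntegral (k := K) (K := A ⧸ m)
      let e : K ≃ₐ[K] (A ⧸ m) := AlgEquiv.ofBijective (Algebra.ofId K (A ⧸ m)) hbij
      have h1 := ha (e.symm.toAlgHom.comp (Ideal.Quotient.mkₐ K m))
      have h2 : a ∈ m := by
        rw [← Ideal.Quotient.eq_zero_iff_mem]
        simpa using h1
      apply hm.ne_top
      rw [Ideal.eq_top_iff_one]
      have := m.sub_mem hmem (m.mul_mem_right y h2)
      simpa using this
    have hJ : IsJacobsonRing A := isJacobsonRing_of_finiteType (A := K)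
    rw [hJ.out (Ideal.isRadical_iff_quotient_reduced ⊥ |>.mpr (by infer_instance : IsReduced (A ⧸ (⊥ : Ideal A))))] at this
    simpa using this
  have : Nontrivial (TensorProduct K A A') := inferInstance
  have : NoZeroDivisors (TensorProduct K A A') := by
    constructor
    intro u v huv
    by_contra! h
    obtain ⟨hu, hv⟩ := h
    have hu' : b.repr u ≠ 0 := by simpa using hu
    have hv' : b.repr v ≠ 0 := by simpa using hv
    obtain ⟨i, hi⟩ := Finsupp.ne_iff.mp hu'
    obtain ⟨j, hj⟩ := Finsupp.ne_iff.mp hv'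
    have hlin : ∀ (χ : A →ₐ[K] K) (u : TensorProduct K A A'),
        (b.repr u).sum (fun i a => χ a • c i) = 0 → ∀ i, χ (b.repr u i) = 0 := by
      intro χ u h i
      have h2 := congrArg (fun w => c.repr w i) h
      by_cases hi : i ∈ (b.repr u).support
      · simpa [Finsupp.sum, Finsupp.single_apply, hi, map_sum, Finsupp.finsetSum_apply] using h2
      · rw [Finsupp.notMem_support_iff.mp hi, map_zero]
    have hz : b.repr u i * b.repr v j = 0 := by
      apply hjac
      intro χ
      have h1 := congrArg (Algebra.TensorProduct.lift ((Algebra.ofId K A').comp χ) (AlgHom.id K A')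
        (fun _ _ => Commute.all _ _)) huv
      rw [map_mul, map_zero, hpt, hpt] at h1
      rw [map_mul]
      rcases mul_eq_zero.mp h1 with h | h
      · rw [hlin χ u h, zero_mul]
      · rw [hlin χ v h, mul_zero]
    rcases mul_eq_zero.mp hz with h | h
    · exact hi h
    · exact hj h
  exact { }

end GalLine

namespace GalLine

/-- affine Hessian expression -/
noncomputable def hs {K : Type*} [Field K] (f : MvPolynomial (Fin 2) K) :
    MvPolynomial (Fin 2) K :=
  pderiv 0 (pderiv 0 f) * pderiv 1 f ^ 2 - 2 * pderiv 0 (pderiv 1 f) * pderiv 0 f * pderiv 1 f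
    + pderiv 1 (pderiv 1 f) * pderiv 0 f ^ 2

/-- The consequences of the hypotheses used in the sequel. -/
structure Good {K : Type*} [Field K] (f : MvPolynomial (Fin 2) K) (d : ℕ) : Prop where
  irr : Irreducible f
  deg : f.totalDegree = d
  hd : 2 ≤ d
  two : (2 : K) ≠ 0
  hh : ¬ f ∣ hs f
  sm : ∀ Q : Fin 2 → K, eval Q f = 0 → eval Q (pderiv 0 f) = 0 → eval Q (pderiv 1 f) ≠ 0
  low : ∀ α β : K, f ∣ C α * pderiv 0 f + C β * pderiv 1 f → C α * pderiv 0 f + C β * pderiv 1 f = 0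
  lead : ∃ F : MvPolynomial (Fin 3) K, F.IsHomogeneous d ∧ dh K F = f ∧
    ∃ l, eval ![0, l, 1] F ≠ 0

lemma good_of {K : Type*} [Field K] [IsAlgClosed K] {F : MvPolynomial (Fin 3) K} {d : ℕ}
    (hF : F.IsHomogeneous d) (hdeg : (dh K F).totalDegree = d) (hirr : Irreducible (dh K F))
    (hd : 2 ≤ d) (hdK : (d : K) ≠ 0) (hdK' : ((d - 1 : ℕ) : K) ≠ 0)
    (hsm : ∀ x : Fin 3 → K, x ≠ 0 → eval x F = 0 → ∃ j, eval x (pderiv j F) ≠ 0) :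
    Good (dh K F) d := by
  have : Infinite K := IsAlgClosed.instInfinite
  have hp0 : pderiv 0 (dh K F) = dh K (pderiv 1 F) := dh_pderiv F 0
  have hp1 : pderiv 1 (dh K F) = dh K (pderiv 2 F) := dh_pderiv F 1
  refine ⟨hirr, hdeg, hd, ?_, ?_, ?_, ?_, ⟨F, hF, rfl, exists_lam hF hdeg hirr (by omega)⟩⟩
  · intro h2
    rcases Nat.even_or_odd d with ⟨e, he⟩ | ⟨e, he⟩
    · apply hdK
      rw [he, ← two_mul]; push_cast; rw [h2, zero_mul]
    · apply hdK'
      rw [he, Nat.add_sub_cancel]; push_cast; rw [h2, zero_mul]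
  · intro h
    apply hess_not_dvd hF hdeg hirr hd hdK hdK' hsm
    have hhom : (hess F).IsHomogeneous ((d - 1 - 1) + (d - 1) * 2) := by
      have e2 : ∀ i, ((pderiv i F) ^ 2).IsHomogeneous ((d - 1) * 2) := fun i => (hF.pderiv).pow 2
      unfold hess
      refine ((hF.pderiv.pderiv.mul (e2 2)).sub ?_).add (hF.pderiv.pderiv.mul (e2 1))
      have h3 := (((hF.pderiv (i := 2)).pderiv (i := 1)).mul
        (((hF.pderiv (i := 1)).mul (hF.pderiv (i := 2))))).C_mul (2 : K)
      convert! h3 using 1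
      · rw [map_ofNat]; ring
      · omega
    apply deh_dvd hF hdeg hirr.ne_zero hhom
    have : dh K (hess F) = hs (dh K F) := by
      have q := fun (G) => dh_pderiv (K := K) G
      have h1 : ∀ G, pderiv 0 (dh K G) = dh K (pderiv 1 G) := fun G => dh_pderiv G 0
      have h2 : ∀ G, pderiv 1 (dh K G) = dh K (pderiv 2 G) := fun G => dh_pderiv G 1
      have h3 : dh K 2 = 2 := map_ofNat _ 2
      simp [hess, hs, h1, h2, h3]
    rwa [this]
  · intro Q h1 h2 h3
    have ev : ∀ G, eval Q (dh K G) = eval ![1, Q 0, Q 1] G := fun G => aeval_dh Q G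
    rw [hp0] at h2
    rw [hp1] at h3
    rw [ev] at h1 h2 h3
    have hx : (![1, Q 0, Q 1] : Fin 3 → K) ≠ 0 := by
      intro h
      have := congrFun h 0
      simp at this
    obtain ⟨j, hj⟩ := hsm _ hx h1
    have hE := congrArg (eval ![1, Q 0, Q 1]) hF.sum_X_mul_pderiv
    simp only [Fin.sum_univ_three, nsmul_eq_mul, map_add, map_mul, h1, h2, h3, mul_zero,
      add_zero, eval_X, Matrix.cons_val_zero, one_mul] at hE
    fin_cases j
    · exact hj hE
    · exact hj h2
    · exact hj h3
  · intro α β h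
    by_contra hne
    rw [hp0, hp1] at h hne
    have e : C α * dh K (pderiv 1 F) + C β * dh K (pderiv 2 F) =
        dh K (C α * pderiv 1 F + C β * pderiv 2 F) := by
      simp
    rw [e] at h hne
    obtain ⟨q, hq⟩ := h
    have hq0 : q ≠ 0 := by rintro rfl; exact hne (by rw [hq, mul_zero])
    have h1 := totalDegree_mul_of_isDomain hirr.ne_zero hq0
    rw [← hq, hdeg] at h1
    have h2 := totalDegree_dh (C α * pderiv 1 F + C β * pderiv 2 F)
    have h3 : (C α * pderiv 1 F + C β * pderiv 2 F).IsHomogeneous (d - 1) :=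
      (hF.pderiv.C_mul _).add (hF.pderiv.C_mul _)
    have := h3.totalDegree_le
    omega

/-- `P` is a generic point of `f = 0`. -/
def Gen {K E : Type*} [Field K] [Field E] [Algebra K E] (f : MvPolynomial (Fin 2) K)
    (P : Fin 2 → E) : Prop := ∀ g, aeval P g = 0 ↔ f ∣ g

/-- affine coordinate ring -/
abbrev AA {K : Type*} [Field K] (f : MvPolynomial (Fin 2) K) : Type _ :=
  MvPolynomial (Fin 2) K ⧸ Ideal.span {f}

lemma AA_domain {K : Type*} [Field K] {f : MvPolynomial (Fin 2) K} (hf : Irreducible f) :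
    IsDomain (AA f) := by
  have : (Ideal.span {f}).IsPrime := by
    rw [Ideal.span_singleton_prime hf.ne_zero]; exact hf.prime
  infer_instance

/-- The tautological point. -/
noncomputable def pt {K : Type*} [Field K] (f : MvPolynomial (Fin 2) K) : Fin 2 → AA f :=
  fun i => Ideal.Quotient.mkₐ K (Ideal.span {f}) (X i)

lemma aeval_pt {K : Type*} [Field K] (f g : MvPolynomial (Fin 2) K) :
    aeval (pt f) g = Ideal.Quotient.mkₐ K (Ideal.span {f}) g := by
  have : aeval (pt f) = Ideal.Quotient.mkₐ K (Ideal.span {f}) := by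
    ext i; simp [pt]
  rw [this]

lemma aeval_pt_eq_zero {K : Type*} [Field K] (f g : MvPolynomial (Fin 2) K) :
    aeval (pt f) g = 0 ↔ f ∣ g := by
  rw [aeval_pt, Ideal.Quotient.mkₐ_eq_mk, Ideal.Quotient.eq_zero_iff_mem,
    Ideal.mem_span_singleton]

lemma aeval_pt_surj {K : Type*} [Field K] (f : MvPolynomial (Fin 2) K) (y : AA f) :
    ∃ g : MvPolynomial (Fin 2) K, aeval (pt f) g = y := by
  obtain ⟨g, rfl⟩ := Ideal.Quotient.mkₐ_surjective K (Ideal.span {f}) y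
  exact ⟨g, aeval_pt f g⟩

/-- point gives hom -/
noncomputable def ptHom {K E : Type*} [Field K] [CommRing E] [Algebra K E]
    {f : MvPolynomial (Fin 2) K} (Q : Fin 2 → E) (hQ : aeval Q f = 0) : AA f →ₐ[K] E :=
  Ideal.Quotient.liftₐ _ (aeval Q) (by
    intro a ha
    rw [Ideal.mem_span_singleton] at ha
    obtain ⟨q, rfl⟩ := ha
    rw [map_mul, hQ, zero_mul])

lemma ptHom_aeval {K E : Type*} [Field K] [CommRing E] [Algebra K E]
    {f : MvPolynomial (Fin 2) K} (Q : Fin 2 → E) (hQ : aeval Q f = 0) (g : MvPolynomial (Fin 2) K) :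
    ptHom Q hQ (aeval (pt f) g) = aeval Q g := by
  rw [aeval_pt]; rfl

lemma ptHom_pt {K E : Type*} [Field K] [CommRing E] [Algebra K E]
    {f : MvPolynomial (Fin 2) K} (Q : Fin 2 → E) (hQ : aeval Q f = 0) (i) :
    ptHom Q hQ (pt f i) = Q i := by
  have := ptHom_aeval Q hQ (X i)
  simpa using this

lemma AA_alg {K : Type*} [Field K] {f : MvPolynomial (Fin 2) K} (hf : Irreducible f) :
    ∃ u : AA f, ∀ y : AA f, IsAlgebraic (Algebra.adjoin K {u}) y := by
  have := AA_domain hf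
  have htop : Algebra.adjoin K (Set.range (pt f)) = ⊤ := by
    rw [Algebra.adjoin_range_eq_range_aeval, eq_top_iff]
    intro y _
    exact aeval_pt_surj f y
  have halg : Algebra.IsAlgebraic (Algebra.adjoin K (Set.range (pt f))) (AA f) := by
    constructor
    intro y
    exact isAlgebraic_algebraMap (⟨y, htop ▸ trivial⟩ : Algebra.adjoin K (Set.range (pt f)))
  by_cases hinj : Function.Injective (pt f)
  swap
  · have h01 : pt f 0 = pt f 1 := by
      by_contra hne
      apply hinj
      intro i j hij
      fin_cases i <;> fin_cases j <;> simp_all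
    have hr : Set.range (pt f) = {pt f 0} := by
      ext z
      simp [Set.mem_range, Fin.exists_fin_two, ← h01, eq_comm]
    rw [hr] at halg
    exact ⟨pt f 0, fun y => halg.isAlgebraic y⟩
  obtain ⟨s, hs, hB⟩ := exists_isTranscendenceBasis_subset (R := K) (Set.range (pt f))
  have h1 : ∃ i, pt f i ∉ s := by
    by_contra! hcon
    have h2 : AlgebraicIndependent K (pt f) := by
      exact hB.1.comp (fun i => (⟨pt f i, hcon i⟩ : s)) (fun i j hij => hinj (by simpa using hij))
    have h3 : aeval (pt f) f = 0 := (aeval_pt_eq_zero f f).mpr dvd_rfl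
    exact hf.ne_zero (h2 (by rw [h3, map_zero]))
  obtain ⟨i, hi⟩ := h1
  have hB' := hB.isAlgebraic
  rw [Subtype.range_coe] at hB'
  refine ⟨pt f (1 - i), fun y => ?_⟩
  have hsub : s ⊆ {pt f (1 - i)} := by
    intro z hz
    obtain ⟨j, rfl⟩ := hs hz
    have : j ≠ i := by rintro rfl; exact hi hz
    have : j = 1 - i := by omega
    rw [this]; rfl
  exact (hB'.isAlgebraic y).adjoin_of_forall_isAlgebraic fun x hx =>
    absurd (hsub hx.1) hx.2

end GalLine

namespace GalLine

lemma trdeg_AA {K : Type*} [Field K] {f : MvPolynomial (Fin 2) K} (hf : Irreducible f) :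
    Algebra.trdeg K (AA f) ≤ (1 : ℕ) := by
  have := AA_domain hf
  obtain ⟨u, hu⟩ := AA_alg hf
  have : Algebra.IsAlgebraic (Algebra.adjoin K {u}) (AA f) := ⟨hu⟩
  have := Algebra.IsAlgebraic.trdeg_le_cardinalMk K ({u} : Set (AA f))
  simpa using this

lemma gen_iff {K E : Type*} [Field K] [Field E] [Algebra K E]
    {f : MvPolynomial (Fin 2) K} (Q : Fin 2 → E) (hQ : aeval Q f = 0) :
    Gen f Q ↔ Function.Injective (ptHom Q hQ) := by
  rw [injective_iff_map_eq_zero]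
  constructor
  · intro h y hy
    obtain ⟨g, rfl⟩ := aeval_pt_surj f y
    rw [ptHom_aeval, h] at hy
    rwa [aeval_pt_eq_zero]
  · intro h g
    constructor
    · intro hg
      rw [← aeval_pt_eq_zero]
      apply h
      rwa [ptHom_aeval]
    · rintro ⟨q, rfl⟩
      rw [map_mul, hQ, zero_mul]

lemma gen_of_transc {K E : Type*} [Field K] [Field E] [Algebra K E]
    {f : MvPolynomial (Fin 2) K} (hf : Irreducible f) (Q : Fin 2 → E) (hQ : aeval Q f = 0)
    (y : E) (hy : Transcendental K y) (hy2 : IsAlgebraic (ptHom Q hQ).range y) : Gen f Q := by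
  have := AA_domain hf
  rw [gen_iff Q hQ]
  exact inj_of_indep 1 (trdeg_AA hf) _ (fun _ => y)
    (algebraicIndependent_unique_type_iff.mpr hy) (fun _ => hy2)

section
variable {K : Type*} [Field K] {f : MvPolynomial (Fin 2) K} {d : ℕ}

lemma fX_ne {E : Type*} [Field E] [Algebra K E] (hf : Good f d) {P : Fin 2 → E} (hP : Gen f P) :
    aeval P (pderiv 1 f) ≠ 0 := by
  intro h
  rw [hP] at h
  have h1 := hf.low 0 1 (by simpa using h)
  simp only [C_0, C_1, zero_mul, one_mul, zero_add] at h1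
  apply hf.hh
  simp [hs, h1]

lemma slope_transc [IsAlgClosed K] {E : Type*} [Field E] [Algebra K E] (hf : Good f d)
    {P : Fin 2 → E} (hP : Gen f P) {a : E}
    (ha : aeval P (pderiv 0 f) + a * aeval P (pderiv 1 f) = 0) : Transcendental K a := by
  intro halg
  have hIntg : IsIntegral K a := halg.isIntegral
  obtain ⟨c, hc⟩ := (IsAlgClosed.algebraMap_bijective_of_isIntegral
    (k := K) (K := integralClosure K E)).2 (⟨a, hIntg⟩ : integralClosure K E)
  have hc' : algebraMap K E c = a := congrArg Subtype.val hc
  have h1 : f ∣ C 1 * pderiv 0 f + C c * pderiv 1 f := by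
    rw [← hP]
    simp [hc', ha]
  have h2 := hf.low 1 c h1
  have h3 : pderiv 0 f = - C c * pderiv 1 f := by
    rw [C_1, one_mul] at h2
    linear_combination h2
  apply hf.hh
  have h4 : pderiv 0 (pderiv 1 f) = - C c * pderiv 1 (pderiv 1 f) := by
    rw [pderiv_comm', h3]; simp
  have h5 : pderiv 0 (pderiv 0 f) = C c * C c * pderiv 1 (pderiv 1 f) := by
    rw [h3]; simp [h4]; ring
  have : hs f = 0 := by
    rw [hs, h5, h4, h3]; ring
  rw [this]; exact dvd_zero _

lemma sec_ne {E : Type*} [Field E] [Algebra K E] (hf : Good f d)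
    {P : Fin 2 → E} (hP : Gen f P) {a : E}
    (ha : aeval P (pderiv 0 f) + a * aeval P (pderiv 1 f) = 0) :
    aeval P (pderiv 0 (pderiv 0 f)) + 2 * a * aeval P (pderiv 0 (pderiv 1 f)) +
      a ^ 2 * aeval P (pderiv 1 (pderiv 1 f)) ≠ 0 := by
  intro h
  apply hf.hh
  rw [← hP]
  have e : aeval P (pderiv 0 f) = - a * aeval P (pderiv 1 f) := by linear_combination ha
  have h2 : (aeval P (2 : MvPolynomial (Fin 2) K)) = 2 := map_ofNat _ 2
  simp only [hs, map_add, map_sub, map_mul, map_pow, e, h2]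
  linear_combination (aeval P (pderiv 1 f)) ^ 2 * h

lemma sm_ext [IsAlgClosed K] {E : Type*} [Field E] [Algebra K E] (hf : Good f d) {Q : Fin 2 → E}
    (h0 : aeval Q f = 0) (h1 : aeval Q (pderiv 0 f) = 0) : aeval Q (pderiv 1 f) ≠ 0 := by
  intro h2
  set I : Ideal (MvPolynomial (Fin 2) K) := Ideal.span {f, pderiv 0 f, pderiv 1 f} with hI
  have hy : (1 : MvPolynomial (Fin 2) K) ∈ vanishingIdeal K (zeroLocus K I) := by
    rw [mem_vanishingIdeal_iff]
    intro x hx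
    rw [mem_zeroLocus_iff] at hx
    have hm : ∀ z ∈ ({f, pderiv 0 f, pderiv 1 f} : Set _), eval x z = 0 :=
      fun z hz => hx z (Ideal.subset_span hz)
    exact absurd (hm _ (by simp)) (hf.sm x (hm _ (by simp)) (hm _ (by simp)))
  rw [vanishingIdeal_zeroLocus_eq_radical] at hy
  obtain ⟨N, hN⟩ := hy
  have hle : I ≤ RingHom.ker (aeval Q : MvPolynomial (Fin 2) K →ₐ[K] E) := by
    rw [hI, Ideal.span_le]
    rintro z (rfl | rfl | rfl)
    · exact h0
    · exact h1
    · exact h2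
  have := hle hN
  simp [RingHom.mem_ker] at this

variable {M N : Type*} [Field M] [Algebra K M] [AddCommGroup N] [Module M N] [Module K N]
  [IsScalarTower K M N]

lemma der_x (hf : Good f d) {P : Fin 2 → M} (hP : Gen f P) {a : M}
    (ha : aeval P (pderiv 0 f) + a * aeval P (pderiv 1 f) = 0) (D : Derivation K M N) :
    D (P 1) = a • D (P 0) := by
  have h0 : aeval P f = 0 := (hP f).mpr dvd_rfl
  have h1 := deriv_aeval D P f
  rw [h0, map_zero, Fin.sum_univ_two] at h1
  have e : aeval P (pderiv 0 f) = - a * aeval P (pderiv 1 f) := by linear_combination ha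
  rw [e] at h1
  have h2 : aeval P (pderiv 1 f) • (D (P 1) - a • D (P 0)) = 0 := by
    rw [h1]; module
  exact sub_eq_zero.mp ((smul_eq_zero.mp h2).resolve_left (fX_ne hf hP))

lemma der_b (hf : Good f d) {P : Fin 2 → M} (hP : Gen f P) {a : M}
    (ha : aeval P (pderiv 0 f) + a * aeval P (pderiv 1 f) = 0) (D : Derivation K M N) :
    D (P 1 - a * P 0) = - (P 0) • D a := by
  rw [map_sub, Derivation.leibniz, der_x hf hP ha D]
  module

lemma der_t (hf : Good f d) {P : Fin 2 → M} (hP : Gen f P) {a : M}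
    (ha : aeval P (pderiv 0 f) + a * aeval P (pderiv 1 f) = 0) (D : Derivation K M N)
    (hD : D a = 0) : D (P 0) = 0 := by
  have h1 := congrArg D ha
  rw [map_add, Derivation.leibniz, hD, deriv_aeval, deriv_aeval, Fin.sum_univ_two,
    Fin.sum_univ_two, map_zero, der_x hf hP ha D, pderiv_comm' f 1 0] at h1
  have h2 : (aeval P (pderiv 0 (pderiv 0 f)) + 2 * a * aeval P (pderiv 0 (pderiv 1 f)) +
      a ^ 2 * aeval P (pderiv 1 (pderiv 1 f))) • D (P 0) = 0 := by
    rw [← h1]; module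
  exact (smul_eq_zero.mp h2).resolve_left (sec_ne hf hP ha)

lemma der_zero (hf : Good f d) {P : Fin 2 → M} (hP : Gen f P) {a : M}
    (ha : aeval P (pderiv 0 f) + a * aeval P (pderiv 1 f) = 0)
    (hgen : ∀ m : M, ∃ g h : MvPolynomial (Fin 2) K, m = aeval P g / aeval P h)
    (D : Derivation K M N) (hD : D a = 0) : D = 0 := by
  have ht := der_t hf hP ha D hD
  have hx := der_x hf hP ha D
  rw [ht, smul_zero] at hx
  have h : ∀ g : MvPolynomial (Fin 2) K, D (aeval P g) = 0 := by
    intro g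
    rw [deriv_aeval, Fin.sum_univ_two, ht, hx]; simp
  ext m
  obtain ⟨g, h', rfl⟩ := hgen m
  rw [Derivation.leibniz_div, h, h]; simp

end

end GalLine

namespace GalLine
universe u
open scoped IntermediateField.algebraAdjoinAdjoin

lemma bivar_pderiv {K : Type u} [Field K] (Q : Polynomial (Polynomial K)) :
    pderiv 1 (Q.eval₂ (Polynomial.aeval (X 0 : MvPolynomial (Fin 2) K)).toRingHom (X 1)) =
      Q.derivative.eval₂ (Polynomial.aeval (X 0 : MvPolynomial (Fin 2) K)).toRingHom (X 1) := by
  induction Q using Polynomial.induction_on' with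
  | add p q hp hq => simp only [Polynomial.eval₂_add, map_add, hp, hq]
  | monomial n g =>
    have h0 : pderiv 1 (Polynomial.aeval (X 0 : MvPolynomial (Fin 2) K) g) = 0 := by
      rw [Derivation.map_aeval, pderiv_X]
      simp
    have e : (Polynomial.aeval (X 0 : MvPolynomial (Fin 2) K)).toRingHom g =
      Polynomial.aeval (X 0 : MvPolynomial (Fin 2) K) g := rfl
    have e' : (Polynomial.aeval (X 0 : MvPolynomial (Fin 2) K)).toRingHom (g * (n : Polynomial K)) =
      Polynomial.aeval (X 0 : MvPolynomial (Fin 2) K) g * n := by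
      rw [map_mul, map_natCast]; rfl
    rw [Polynomial.derivative_monomial, Polynomial.eval₂_monomial, Polynomial.eval₂_monomial, e',
      pderiv_mul, e, h0, Derivation.leibniz_pow, pderiv_X_self]
    simp only [zero_mul, zero_add, smul_eq_mul, mul_one, nsmul_eq_mul]
    ring

lemma exists_sep_rel {K M : Type u} [Field K] [Field M] [Algebra K M] [Algebra.EssFiniteType K M]
    (a b : M) (hder : ∀ (N : Type u) [AddCommGroup N] [Module M N] [Module K N]
      [IsScalarTower K M N] (D : Derivation K M N), D a = 0 → D = 0) :
    ∃ Φ : MvPolynomial (Fin 2) K, aeval ![a, b] Φ = 0 ∧ aeval ![a, b] (pderiv 1 Φ) ≠ 0 := by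
  let k0 := IntermediateField.adjoin K {a}
  have hess : Algebra.EssFiniteType k0 M := Algebra.EssFiniteType.of_comp K k0 M
  have hsep : Algebra.IsSeparable k0 M := by
    rw [← Algebra.FormallyUnramified.iff_isSeparable]
    rw [Algebra.formallyUnramified_iff]
    let D := KaehlerDifferential.D k0 M
    have hD : D.restrictScalars K = 0 := by
      apply hder
      change D a = 0
      exact D.map_algebraMap (⟨a, IntermediateField.mem_adjoin_simple_self K a⟩ : k0)
    rw [← Submodule.subsingleton_iff M, ← subsingleton_iff_bot_eq_top,
      ← KaehlerDifferential.span_range_derivation]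
    symm
    rw [Submodule.span_eq_bot]
    rintro _ ⟨y, rfl⟩
    exact DFunLike.congr_fun hD y
  have hb := hsep.isSeparable' b
  have hbi : IsIntegral k0 b := hb.isIntegral
  set m := minpoly k0 b with hm
  have hm0 : Polynomial.aeval b m = 0 := minpoly.aeval _ _
  have hm1 : Polynomial.aeval b m.derivative ≠ 0 :=
    Polynomial.Separable.aeval_derivative_ne_zero hb hm0
  obtain ⟨c, hc, hq⟩ := IsLocalization.integerNormalization_spec
    (nonZeroDivisors (Algebra.adjoin K {a})) m
  set q := IsLocalization.integerNormalization (nonZeroDivisors (Algebra.adjoin K {a})) m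
  have hc0 : (c : M) ≠ 0 := by
    intro h
    exact nonZeroDivisors.ne_zero hc (Subtype.ext h)
  let ρ : Polynomial K →ₐ[K] Algebra.adjoin K {a} :=
    Polynomial.aeval ⟨a, Algebra.self_mem_adjoin_singleton K a⟩
  have hρ : Function.Surjective ρ := by
    rintro ⟨y, hy⟩
    have hy' := hy
    rw [Algebra.adjoin_singleton_eq_range_aeval] at hy'
    obtain ⟨g, rfl⟩ := hy'
    refine ⟨g, Subtype.ext ?_⟩
    have := Polynomial.aeval_algHom_apply (Algebra.adjoin K {a}).val
      ⟨a, Algebra.self_mem_adjoin_singleton K a⟩ g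
    exact this.symm
  obtain ⟨Q, hQ⟩ := Polynomial.map_surjective (ρ : Polynomial K →+* Algebra.adjoin K {a}) hρ q
  have key : ∀ Q' : Polynomial (Polynomial K),
      aeval ![a, b] (Q'.eval₂ (Polynomial.aeval (X 0 : MvPolynomial (Fin 2) K)).toRingHom (X 1)) =
      Polynomial.aeval b ((Q'.map (ρ : Polynomial K →+* Algebra.adjoin K {a})).map
        (algebraMap (Algebra.adjoin K {a}) k0)) := by
    intro Q'
    rw [Polynomial.map_map, Polynomial.aeval_def, Polynomial.eval₂_map]
    rw [← AlgHom.coe_toRingHom, Polynomial.hom_eval₂]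
    have h1 : (aeval ![a, b] : MvPolynomial (Fin 2) K →ₐ[K] M).toRingHom (X 1) = b := by simp
    have h2 : (aeval ![a, b] : MvPolynomial (Fin 2) K →ₐ[K] M).toRingHom.comp
        (Polynomial.aeval (X 0 : MvPolynomial (Fin 2) K)).toRingHom =
        (algebraMap k0 M).comp ((algebraMap (Algebra.adjoin K {a}) k0).comp
          (ρ : Polynomial K →+* Algebra.adjoin K {a})) := by
      apply Polynomial.ringHom_ext
      · intro r
        simp [ρ]
        rfl
      · simp [ρ]
        rfl
    rw [← h2]
    exact congrArg (fun z => Polynomial.eval₂ _ z Q') h1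
  have hsmul : ∀ r : Polynomial k0, Polynomial.aeval b (c • r) = (c : M) * Polynomial.aeval b r := by
    intro r
    rw [← IsScalarTower.algebraMap_smul k0 c r, Polynomial.smul_eq_C_mul, map_mul,
      Polynomial.aeval_C]
    rfl
  refine ⟨Q.eval₂ (Polynomial.aeval (X 0 : MvPolynomial (Fin 2) K)).toRingHom (X 1), ?_, ?_⟩
  · rw [key, hQ, hq, hsmul, hm0, mul_zero]
  · rw [bivar_pderiv, key, ← Polynomial.derivative_map, hQ, ← Polynomial.derivative_map, hq,
      Polynomial.derivative_smul, hsmul]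
    exact mul_ne_zero hc0 hm1

end GalLine

namespace GalLine
universe u

lemma phi_rel {K M : Type u} [Field K] [IsAlgClosed K] [Field M] [Algebra K M]
    [Algebra.EssFiniteType K M] {f : MvPolynomial (Fin 2) K} {d : ℕ} (hf : Good f d)
    {P : Fin 2 → M} (hP : Gen f P) {a : M}
    (ha : aeval P (pderiv 0 f) + a * aeval P (pderiv 1 f) = 0)
    (hgen : ∀ m : M, ∃ g h : MvPolynomial (Fin 2) K, m = aeval P g / aeval P h) :
    ∃ Φ : MvPolynomial (Fin 2) K, aeval ![a, P 1 - a * P 0] (pderiv 1 Φ) ≠ 0 ∧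
      aeval ![a, P 1 - a * P 0] (pderiv 0 Φ) =
        P 0 * aeval ![a, P 1 - a * P 0] (pderiv 1 Φ) := by
  obtain ⟨Φ, h1, h2⟩ := exists_sep_rel (K := K) a (P 1 - a * P 0)
    (fun N _ _ _ _ D hD => der_zero hf hP ha hgen D hD)
  refine ⟨Φ, h2, ?_⟩
  let D := KaehlerDifferential.D K M
  have hDa : D a ≠ 0 := by
    intro h
    have hD : D = 0 := der_zero hf hP ha hgen D h
    have hu : Algebra.FormallyUnramified K M := by
      rw [Algebra.formallyUnramified_iff, ← Submodule.subsingleton_iff M,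
        ← subsingleton_iff_bot_eq_top, ← KaehlerDifferential.span_range_derivation]
      symm
      rw [Submodule.span_eq_bot]
      rintro _ ⟨y, rfl⟩
      exact DFunLike.congr_fun hD y
    have hs : Algebra.IsSeparable K M := by
      rw [← Algebra.FormallyUnramified.iff_isSeparable]; exact hu
    exact slope_transc hf hP ha (hs.isSeparable' a).isIntegral.isAlgebraic
  have h3 := deriv_aeval D ![a, P 1 - a * P 0] Φ
  rw [h1, map_zero, Fin.sum_univ_two] at h3
  simp only [Matrix.cons_val_zero, Matrix.cons_val_one] at h3
  rw [der_b hf hP ha D] at h3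
  have h4 : (aeval ![a, P 1 - a * P 0] (pderiv 0 Φ) -
      P 0 * aeval ![a, P 1 - a * P 0] (pderiv 1 Φ)) • D a = 0 := by
    rw [h3]; module
  exact sub_eq_zero.mp ((smul_eq_zero.mp h4).resolve_right hDa)

lemma gen_frac {K : Type u} [Field K] {f : MvPolynomial (Fin 2) K} 
    [IsDomain (AA f)] :
    Gen f (fun i => algebraMap (AA f) (FractionRing (AA f)) (pt f i)) := by
  intro g
  rw [← aeval_pt_eq_zero]
  have : aeval (fun i => algebraMap (AA f) (FractionRing (AA f)) (pt f i)) g =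
    algebraMap (AA f) (FractionRing (AA f)) (aeval (pt f) g) := aeval_algebraMap_apply _ _ _
  rw [this]
  exact FaithfulSMul.algebraMap_eq_zero_iff _ _

lemma no_bitangent {K : Type u} [Field K] [IsAlgClosed K] {f : MvPolynomial (Fin 2) K} {d : ℕ}
    (hf : Good f d) :
    ∃ (k : Type u) (_ : Field k) (_ : Algebra K k) (_ : IsAlgClosed k) (P : Fin 2 → k) (a : k),
      Gen f P ∧ aeval P (pderiv 0 f) + a * aeval P (pderiv 1 f) = 0 ∧
      ∀ Q : Fin 2 → k, aeval Q f = 0 → aeval Q (pderiv 0 f) + a * aeval Q (pderiv 1 f) = 0 →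
        Q 1 - a * Q 0 = P 1 - a * P 0 → Q 0 = P 0 := by
  have := AA_domain hf.irr
  let M := FractionRing (AA f)
  let k := AlgebraicClosure M
  let P : Fin 2 → M := fun i => algebraMap (AA f) M (pt f i)
  have hP : Gen f P := gen_frac
  have haP : ∀ g : MvPolynomial (Fin 2) K, aeval P g = algebraMap (AA f) M (aeval (pt f) g) :=
    fun g => aeval_algebraMap_apply _ _ _
  have hfin : Algebra.FiniteType K (AA f) := inferInstance
  have : Algebra.EssFiniteType (AA f) M :=
    Algebra.EssFiniteType.of_isLocalization M (nonZeroDivisors (AA f))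
  have : Algebra.EssFiniteType K M := Algebra.EssFiniteType.comp K (AA f) M
  let a : M := - aeval P (pderiv 0 f) / aeval P (pderiv 1 f)
  have hfx := fX_ne hf hP
  have ha : aeval P (pderiv 0 f) + a * aeval P (pderiv 1 f) = 0 := by
    have : a * aeval P (pderiv 1 f) = - aeval P (pderiv 0 f) := div_mul_cancel₀ _ hfx
    rw [this, add_neg_cancel]
  have hgen : ∀ m : M, ∃ g h : MvPolynomial (Fin 2) K, m = aeval P g / aeval P h := by
    intro m
    obtain ⟨x, y, hy, rfl⟩ := IsFractionRing.div_surjective (A := AA f) m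
    obtain ⟨g, rfl⟩ := aeval_pt_surj f x
    obtain ⟨h, rfl⟩ := aeval_pt_surj f y
    exact ⟨g, h, by rw [haP, haP]⟩
  obtain ⟨Φ, hΦ1, hΦ2⟩ := phi_rel hf hP ha hgen
  let i : M →ₐ[K] k := IsScalarTower.toAlgHom K M k
  have hi : ∀ (j : M →ₐ[K] k) (g : MvPolynomial (Fin 2) K), aeval (fun n => j (P n)) g = j (aeval P g) := by
    intro j g
    exact (comp_aeval_apply P j g).symm
  refine ⟨k, inferInstance, inferInstance, inferInstance, fun n => i (P n), i a, ?_, ?_, ?_⟩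
  · intro g
    rw [hi, map_eq_zero, hP]
  · rw [hi, hi, ← map_mul, ← map_add, ha, map_zero]
  intro Q hQ0 hQ1 hQ2
  have hfxQ : aeval Q (pderiv 1 f) ≠ 0 := by
    intro h
    rw [h, mul_zero, add_zero] at hQ1
    exact sm_ext hf hQ0 hQ1 h
  have hta : Transcendental K (i a) := by
    intro h
    exact slope_transc hf hP ha ((isAlgebraic_algHom_iff i i.injective).mp h)
  have hQ : Gen f Q := by
    refine gen_of_transc hf.irr Q hQ0 (i a) hta ?_
    have m : ∀ g : MvPolynomial (Fin 2) K, aeval Q g ∈ (ptHom Q hQ0).range :=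
      fun g => ⟨aeval (pt f) g, ptHom_aeval Q hQ0 g⟩
    refine ⟨Polynomial.C ⟨_, m (pderiv 1 f)⟩ * Polynomial.X + Polynomial.C ⟨_, m (pderiv 0 f)⟩,
      ?_, ?_⟩
    · intro h
      have := congrArg (fun q => Polynomial.coeff q 1) h
      simp [Polynomial.coeff_C] at this
      exact hfxQ (congrArg Subtype.val this)
    · simp only [map_add, map_mul, Polynomial.aeval_C, Polynomial.aeval_X]
      change aeval Q (pderiv 1 f) * i a + aeval Q (pderiv 0 f) = 0
      rw [← hQ1]; ring
  have hinj := (gen_iff Q hQ0).mp hQ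
  let j : M →ₐ[K] k := IsFractionRing.liftAlgHom hinj
  have hj : ∀ n, j (P n) = Q n := by
    intro n
    have : j (algebraMap (AA f) M (pt f n)) = ptHom Q hQ0 (pt f n) :=
      IsFractionRing.lift_algebraMap hinj _
    rw [← ptHom_pt Q hQ0 n, ← this]
  have hjg : ∀ g : MvPolynomial (Fin 2) K, j (aeval P g) = aeval Q g := by
    intro g
    rw [← hi]
    congr 2
    funext n
    exact hj n
  have hja : j a = i a := by
    have h1 := congrArg j ha
    rw [map_add, map_mul, hjg, hjg, map_zero] at h1
    have : aeval Q (pderiv 1 f) * (j a - i a) = 0 := by linear_combination h1 - hQ1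
    exact sub_eq_zero.mp ((mul_eq_zero.mp this).resolve_left hfxQ)
  have hjb : j (P 1 - a * P 0) = i (P 1 - a * P 0) := by
    rw [map_sub, map_mul, hj, hj, hja, hQ2, map_sub, map_mul]
  have hv : ∀ (l : M →ₐ[K] k) (g : MvPolynomial (Fin 2) K),
      l (aeval ![a, P 1 - a * P 0] g) = aeval ![l a, l (P 1 - a * P 0)] g := by
    intro l g
    rw [comp_aeval_apply]
    congr 2
    funext n
    fin_cases n <;> rfl
  have e1 := congrArg i hΦ2
  have e2 := congrArg j hΦ2
  rw [map_mul, hv, hv] at e1 e2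
  rw [hja, hjb, e1] at e2
  have hne : aeval ![i a, i (P 1 - a * P 0)] (pderiv 1 Φ) ≠ 0 := by
    rw [← hv]; exact (map_ne_zero i).mpr hΦ1
  have := mul_right_cancel₀ hne e2
  rw [← hj]; exact this.symm

end GalLine

namespace GalLine
universe u

lemma special_count {k : Type*} [Field k] [IsAlgClosed k] {g : Polynomial k} {t : k}
    [DecidableEq k]
    (hg : g ≠ 0) (h0 : g.eval t = 0) (h1 : g.derivative.eval t = 0)
    (h2 : g.derivative.derivative.eval t ≠ 0)
    (hs : ∀ r, g.eval r = 0 → r ≠ t → g.derivative.eval r ≠ 0) :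
    (g.roots.toFinset.erase t).card + 2 = g.natDegree := by
  have hsum := Multiset.toFinset_sum_count_eq g.roots
  have hcard : g.roots.card = g.natDegree :=
    (IsAlgClosed.splits g).natDegree_eq_card_roots.symm
  have htm : t ∈ g.roots.toFinset := by
    rw [Multiset.mem_toFinset, Polynomial.mem_roots hg]; exact h0
  rw [← Finset.add_sum_erase _ _ htm] at hsum
  have hc2 : g.roots.count t = 2 := by
    rw [Polynomial.count_roots]
    apply le_antisymm
    · by_contra hlt
      push Not at hlt
      have := Polynomial.isRoot_iterate_derivative_of_lt_rootMultiplicity hlt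
      exact h2 this
    · exact (Polynomial.one_lt_rootMultiplicity_iff_isRoot hg).mpr ⟨h0, h1⟩
  have hc1 : ∀ r ∈ g.roots.toFinset.erase t, g.roots.count r = 1 := by
    intro r hr
    rw [Finset.mem_erase, Multiset.mem_toFinset] at hr
    have hr0 := (Polynomial.mem_roots hg).mp hr.2
    apply le_antisymm
    · rw [Polynomial.count_roots]
      by_contra hlt
      push Not at hlt
      exact hs r hr0 hr.1 ((Polynomial.one_lt_rootMultiplicity_iff_isRoot hg).mp hlt).2
    · exact Multiset.one_le_count_iff_mem.mpr hr.2
  rw [Finset.sum_congr rfl hc1, hc2] at hsum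
  simp only [Finset.sum_const, smul_eq_mul, mul_one] at hsum
  omega

lemma hensel_lift {k : Type*} [Field k] (G : Polynomial (PowerSeries k))
    (hG : IsUnit G.leadingCoeff) (r : k)
    (h0 : (G.map PowerSeries.constantCoeff).eval r = 0)
    (h1 : (G.map PowerSeries.constantCoeff).derivative.eval r ≠ 0) :
    ∃ ρ : PowerSeries k, G.eval ρ = 0 ∧ PowerSeries.constantCoeff ρ = r := by
  obtain ⟨v, hv⟩ := hG
  have hr : r = PowerSeries.constantCoeff (PowerSeries.C r) := by simp
  rw [Polynomial.derivative_map] at h1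
  rw [hr, Polynomial.eval_map_apply] at h0 h1
  have hH := (inferInstance : HenselianRing (PowerSeries k)
    (Ideal.span {(PowerSeries.X : PowerSeries k)}))
  have hmem : ∀ z : PowerSeries k, z ∈ Ideal.span {(PowerSeries.X : PowerSeries k)} ↔
      PowerSeries.constantCoeff z = 0 := by
    intro z
    rw [Ideal.mem_span_singleton, PowerSeries.X_dvd_iff]
  obtain ⟨ρ, hρ1, hρ2⟩ := hH.is_henselian (Polynomial.C (↑v⁻¹ : PowerSeries k) * G)
    (by
      rw [Polynomial.Monic, Polynomial.leadingCoeff_mul, Polynomial.leadingCoeff_C, ← hv,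
        Units.inv_mul])
    (PowerSeries.C r) (by
      rw [hmem, Polynomial.eval_mul, map_mul, h0, mul_zero])
    (by
      apply IsUnit.map
      rw [Polynomial.derivative_C_mul, Polynomial.eval_mul, Polynomial.eval_C]
      refine (Units.isUnit _).mul ?_
      rw [PowerSeries.isUnit_iff_constantCoeff]
      exact isUnit_iff_ne_zero.mpr h1)
  refine ⟨ρ, ?_, ?_⟩
  · rw [Polynomial.IsRoot, Polynomial.eval_mul, Polynomial.eval_C] at hρ1
    exact (v⁻¹.isUnit.mul_right_eq_zero).mp hρ1
  · rw [hmem, map_sub, sub_eq_zero] at hρ2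
    simpa using hρ2

/-- a root of a power series polynomial can not specialise to `t` -/
lemma no_root_at {k : Type*} [Field k] (G : Polynomial (PowerSeries k)) (t : k)
    (h1 : (G.map PowerSeries.constantCoeff).derivative.eval t = 0)
    (hs : PowerSeries.coeff 1 (G.eval (PowerSeries.C t)) ≠ 0) (w : PowerSeries k)
    (hw : G.eval w = 0) : PowerSeries.constantCoeff w ≠ t := by
  intro hwt
  have hd : PowerSeries.X ∣ w - PowerSeries.C t := by
    rw [PowerSeries.X_dvd_iff]; simp [hwt]
  obtain ⟨y, hy⟩ := hd
  obtain ⟨c, hc⟩ := Polynomial.binomExpansion G (PowerSeries.C t) (PowerSeries.X * y)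
  rw [← hy, add_sub_cancel, hw, hy] at hc
  have hr : t = PowerSeries.constantCoeff (PowerSeries.C t) := by simp
  rw [Polynomial.derivative_map] at h1
  rw [hr, Polynomial.eval_map_apply] at h1
  obtain ⟨z, hz⟩ := PowerSeries.X_dvd_iff.mpr h1
  apply hs
  have : G.eval (PowerSeries.C t) = PowerSeries.X ^ 2 * (- (z * y) - c * y ^ 2) := by
    rw [hz] at hc
    linear_combination - hc
  rw [this, PowerSeries.coeff_X_pow_mul']
  simp

lemma local_part {k E N : Type*} [Field k] [IsAlgClosed k] (h2k : (2 : k) ≠ 0) [Field E]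
    [Algebra (PowerSeries k) E] [IsFractionRing (PowerSeries k) E] [Field N] [Algebra E N]
    [IsAlgClosed N] [Normal E N] (G : Polynomial (PowerSeries k))
    (hG : IsUnit G.leadingCoeff) (t : k)
    (h0 : (G.map PowerSeries.constantCoeff).eval t = 0)
    (h1 : (G.map PowerSeries.constantCoeff).derivative.eval t = 0)
    (h2 : (G.map PowerSeries.constantCoeff).derivative.derivative.eval t ≠ 0)
    (hsimp : ∀ r, (G.map PowerSeries.constantCoeff).eval r = 0 → r ≠ t →
      (G.map PowerSeries.constantCoeff).derivative.eval r ≠ 0)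
    (hs : PowerSeries.coeff 1 (G.eval (PowerSeries.C t)) ≠ 0) :
    (G.map (algebraMap (PowerSeries k) E)).Separable ∧
    ∃ (σ : N ≃ₐ[E] N) (x y : N), x ≠ y ∧
      Polynomial.aeval x (G.map (algebraMap (PowerSeries k) E)) = 0 ∧
      Polynomial.aeval y (G.map (algebraMap (PowerSeries k) E)) = 0 ∧ σ x = y ∧ σ y = x ∧
      ∀ z, Polynomial.aeval z (G.map (algebraMap (PowerSeries k) E)) = 0 → z ≠ x → z ≠ y →
        σ z = z := by
  classical
  set R := PowerSeries k
  set g := G.map PowerSeries.constantCoeff with hg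
  set Ge := G.map (algebraMap R E) with hGe
  have hinj : Function.Injective (algebraMap R E) := IsFractionRing.injective R E
  have hlc : PowerSeries.constantCoeff G.leadingCoeff ≠ 0 :=
    ((PowerSeries.isUnit_iff_constantCoeff).mp hG).ne_zero
  have hgdeg : g.natDegree = G.natDegree := Polynomial.natDegree_map_of_leadingCoeff_ne_zero _ hlc
  have hg0 : g ≠ 0 := fun h => h2 (by rw [h]; simp)
  have hGedeg : Ge.natDegree = G.natDegree := Polynomial.natDegree_map_eq_of_injective hinj _
  have hG0 : G ≠ 0 := by rintro rfl; exact hg0 (by simp [hg])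
  have hGe0 : Ge ≠ 0 := (Polynomial.map_ne_zero_iff hinj).mpr hG0
  have hcount := special_count hg0 h0 h1 h2 hsimp
  set Z := g.roots.toFinset.erase t with hZ
  have hZm : ∀ r ∈ Z, g.eval r = 0 ∧ r ≠ t := by
    intro r hr
    rw [hZ, Finset.mem_erase, Multiset.mem_toFinset] at hr
    exact ⟨(Polynomial.mem_roots hg0).mp hr.2, hr.1⟩
  have hex : ∀ r : k, ∃ ρ : R, r ∈ Z → G.eval ρ = 0 ∧ PowerSeries.constantCoeff ρ = r := by
    intro r
    by_cases hr : r ∈ Z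
    · obtain ⟨ρ, hρ⟩ := hensel_lift G hG r (hZm r hr).1 (hsimp r (hZm r hr).1 (hZm r hr).2)
      exact ⟨ρ, fun _ => hρ⟩
    · exact ⟨0, fun h => absurd h hr⟩
  choose ρ hρ using hex
  have hρi : ∀ r ∈ Z, ∀ r' ∈ Z, algebraMap R E (ρ r) = algebraMap R E (ρ r') → r = r' := by
    intro r hr r' hr' h
    rw [← (hρ r hr).2, ← (hρ r' hr').2, hinj h]
  set H : Polynomial E := ∏ r ∈ Z, (Polynomial.X - Polynomial.C (algebraMap R E (ρ r))) with hH
  have hHsep : H.Separable := Polynomial.separable_prod_X_sub_C_iff'.mpr hρi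
  have hev : ∀ w : R, Ge.eval (algebraMap R E w) = algebraMap R E (G.eval w) := by
    intro w; rw [hGe, Polynomial.eval_map_apply]
  have hdvd : H ∣ Ge := by
    apply Finset.prod_dvd_of_coprime
    · intro r hr r' hr' hne
      apply Polynomial.isCoprime_X_sub_C_of_isUnit_sub
      rw [isUnit_iff_ne_zero, sub_ne_zero]
      exact fun h => hne (hρi r hr r' hr' h)
    · intro r hr
      rw [Polynomial.dvd_iff_isRoot, Polynomial.IsRoot, hev, (hρ r hr).1, map_zero]
  obtain ⟨q, hq⟩ := hdvd
  have hHdeg : H.natDegree = Z.card := by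
    rw [hH, Polynomial.natDegree_prod_of_monic _ _ (fun i _ => Polynomial.monic_X_sub_C _)]
    simp
  have hH0 : H ≠ 0 := hHsep.ne_zero
  have hq0 : q ≠ 0 := by rintro rfl; exact hGe0 (by rw [hq, mul_zero])
  have hqdeg : q.natDegree = 2 := by
    have := Polynomial.natDegree_mul hH0 hq0
    rw [← hq, hGedeg, ← hgdeg, hHdeg] at this
    omega
  have hnr : ∀ z : E, ¬ q.IsRoot z := by
    intro z hz
    have hzG : Ge.eval z = 0 := by rw [hq, Polynomial.eval_mul, hz, mul_zero]
    have hIntg : IsIntegral R z := by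
      obtain ⟨v, hv⟩ := hG
      refine ⟨Polynomial.C (↑v⁻¹ : R) * G, ?_, ?_⟩
      · rw [Polynomial.Monic, Polynomial.leadingCoeff_mul, Polynomial.leadingCoeff_C, ← hv,
          Units.inv_mul]
      · rw [Polynomial.eval₂_mul, ← Polynomial.eval_map _ (p := G), hzG, mul_zero]
    obtain ⟨w, rfl⟩ := (IsIntegrallyClosed.isIntegral_iff (R := R) (K := E)).mp hIntg
    have hw : G.eval w = 0 := hinj (by rw [← hev, hzG, map_zero])
    have hwt := no_root_at G t h1 hs w hw
    set r := PowerSeries.constantCoeff w with hr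
    have hrg : g.eval r = 0 := by
      rw [hg, hr, Polynomial.eval_map_apply, hw, map_zero]
    have hrZ : r ∈ Z := by
      rw [hZ, Finset.mem_erase, Multiset.mem_toFinset, Polynomial.mem_roots hg0]
      exact ⟨hwt, hrg⟩
    have hder : PowerSeries.constantCoeff (G.derivative.eval w) ≠ 0 := by
      have := hsimp r hrg hwt
      rwa [hg, Polynomial.derivative_map, hr, Polynomial.eval_map_apply] at this
    have hwρ : w = ρ r := by
      apply IsLocalRing.eq_of_eval_eq_zero_of_not_isUnit_sub hw (hρ r hrZ).1
      · rw [PowerSeries.isUnit_iff_constantCoeff, map_sub, (hρ r hrZ).2, ← hr, sub_self]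
        simp
      · rw [PowerSeries.isUnit_iff_constantCoeff]
        exact isUnit_iff_ne_zero.mpr hder
    have hHz : H.eval (algebraMap R E w) = 0 := by
      rw [hH, Polynomial.eval_prod]
      apply Finset.prod_eq_zero hrZ
      rw [hwρ]; simp
    have hd : Ge.derivative.eval (algebraMap R E w) = 0 := by
      rw [hq, Polynomial.derivative_mul, Polynomial.eval_add, Polynomial.eval_mul,
        Polynomial.eval_mul, hHz, hz, mul_zero, zero_mul, add_zero]
    rw [hGe, Polynomial.derivative_map, Polynomial.eval_map_apply] at hd
    apply hder
    rw [hinj (hd.trans (map_zero _).symm), map_zero]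
  have hqirr : Irreducible q := by
    apply Polynomial.irreducible_of_degree_le_three_of_not_isRoot
    · rw [hqdeg]; decide
    · exact hnr
  have h2E : (2 : E) ≠ 0 := by
    intro h
    have h3 : (2 : R) = 0 := hinj (by rw [map_ofNat, h, map_zero])
    apply h2k
    have := congrArg (PowerSeries.constantCoeff (R := k)) h3
    rwa [map_ofNat, map_zero] at this
  have hqsep : q.Separable := by
    rw [Polynomial.separable_iff_derivative_ne_zero hqirr]
    intro h
    have := congrArg (fun p => Polynomial.coeff p 1) h
    simp only [Polynomial.coeff_derivative, Polynomial.coeff_zero] at this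
    have hl : q.coeff 2 ≠ 0 := by
      rw [← hqdeg]; exact Polynomial.leadingCoeff_ne_zero.mpr hq0
    norm_num at this
    exact this.elim hl h2E
  refine ⟨?_, ?_⟩
  · rw [hq]
    apply hHsep.mul hqsep
    rw [hH]
    apply IsCoprime.prod_left
    intro r hr
    rw [(Polynomial.irreducible_X_sub_C _).coprime_iff_not_dvd, Polynomial.dvd_iff_isRoot]
    exact hnr _
  · have hroots : Fintype.card (q.rootSet N) = 2 := by
      rw [Polynomial.card_rootSet_eq_natDegree hqsep (IsAlgClosed.splits _), hqdeg]
    rw [← Nat.card_eq_fintype_card, Nat.card_coe_set_eq, Set.ncard_eq_two] at hroots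
    obtain ⟨x, y, hxy, hset⟩ := hroots
    have hm : ∀ z : N, Polynomial.aeval z q = 0 ↔ z = x ∨ z = y := by
      intro z
      have : z ∈ q.rootSet N ↔ z ∈ ({x, y} : Set N) := by rw [hset]
      rwa [Polynomial.mem_rootSet, and_iff_right hq0] at this
    have hx := (hm x).mpr (Or.inl rfl)
    have hy := (hm y).mpr (Or.inr rfl)
    have hGq : ∀ z : N, Polynomial.aeval z q = 0 → Polynomial.aeval z Ge = 0 := by
      intro z hz; rw [hq, map_mul, hz, mul_zero]
    have hmin : Polynomial.aeval y (minpoly E x) = 0 := by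
      rw [← minpoly.eq_of_irreducible hqirr hx, map_mul, hy, zero_mul]
    obtain ⟨σ, hσ⟩ := minpoly.exists_algEquiv_of_root' (K := E) (L := N)
      ⟨q, hq0, hx⟩ hmin
    refine ⟨σ, x, y, hxy, hGq x hx, hGq y hy, hσ, ?_, ?_⟩
    · have h3 : Polynomial.aeval (σ y) q = 0 := by
        have := Polynomial.aeval_algHom_apply (σ : N →ₐ[E] N) y q
        rw [hy, map_zero] at this
        exact this
      rcases (hm _).mp h3 with h | h
      · exact h
      · exact absurd (σ.injective (hσ.trans h.symm)) hxy
    · intro z hz hzx hzy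
      have hzq : Polynomial.aeval z q ≠ 0 := by
        rw [Ne, hm]; tauto
      rw [hq, map_mul] at hz
      have hzH := (mul_eq_zero.mp hz).resolve_right hzq
      rw [hH, map_prod, Finset.prod_eq_zero_iff] at hzH
      obtain ⟨r, -, hr⟩ := hzH
      rw [map_sub, Polynomial.aeval_X, Polynomial.aeval_C, sub_eq_zero] at hr
      rw [hr, AlgEquiv.commutes]

end GalLine

namespace GalLine
universe u

lemma transp_transfer {L E N : Type*} [Field L] [Field E] [Field N] [Algebra L E] [Algebra E N]
    [Algebra L N] [IsScalarTower L E N] [IsAlgClosed N] (g : Polynomial L) (hg : g ≠ 0)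
    (σ : N ≃ₐ[E] N)
    (x y : N) (hxy : x ≠ y) (hx : Polynomial.aeval x g = 0) (hy : Polynomial.aeval y g = 0)
    (h1 : σ x = y) (h2 : σ y = x)
    (h3 : ∀ z, Polynomial.aeval z g = 0 → z ≠ x → z ≠ y → σ z = z) :
    ∃ (τ : g.SplittingField ≃ₐ[L] g.SplittingField) (x y : g.SplittingField), x ≠ y ∧
      x ∈ g.rootSet g.SplittingField ∧ y ∈ g.rootSet g.SplittingField ∧ τ x = y ∧ τ y = x ∧
      ∀ z ∈ g.rootSet g.SplittingField, z ≠ x → z ≠ y → τ z = z := by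
  let e : g.SplittingField →ₐ[L] N := Polynomial.SplittingField.lift g (IsAlgClosed.splits _)
  let _ : Algebra g.SplittingField N := e.toRingHom.toAlgebra
  have : IsScalarTower L g.SplittingField N := IsScalarTower.of_algebraMap_eq (fun r => by
    exact (e.commutes r).symm)
  have he : ∀ z, algebraMap g.SplittingField N z = e z := fun z => rfl
  have : Normal L g.SplittingField := Normal.of_isSplittingField g
  let τ := (σ.restrictScalars L).restrictNormal g.SplittingField
  have hτ : ∀ z, e (τ z) = σ (e z) := fun z =>
    AlgEquiv.restrictNormal_commutes (σ.restrictScalars L) g.SplittingField z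
  have hr : ∀ z : g.SplittingField, z ∈ g.rootSet g.SplittingField ↔
      Polynomial.aeval (e z) g = 0 := by
    intro z
    rw [Polynomial.mem_rootSet, and_iff_right hg, Polynomial.aeval_algHom_apply]
    exact (map_eq_zero e).symm
  have hsurj : ∀ w : N, Polynomial.aeval w g = 0 → ∃ z, e z = w := by
    intro w hw
    have hsp := Polynomial.SplittingField.splits g
    have := Polynomial.Splits.image_rootSet hsp e
    have hw' : w ∈ g.rootSet N := Polynomial.mem_rootSet.mpr ⟨hg, hw⟩
    rw [← this] at hw'
    obtain ⟨z, -, hz⟩ := hw'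
    exact ⟨z, hz⟩
  obtain ⟨x', rfl⟩ := hsurj x hx
  obtain ⟨y', rfl⟩ := hsurj y hy
  refine ⟨τ, x', y', fun h => hxy (by rw [h]), (hr _).mpr hx, (hr _).mpr hy, ?_, ?_, ?_⟩
  · exact e.injective ((hτ _).trans h1)
  · exact e.injective ((hτ _).trans h2)
  · intro z hz hzx hzy
    exact e.injective ((hτ _).trans
      (h3 _ ((hr z).mp hz) (fun h => hzx (e.injective h)) (fun h => hzy (e.injective h))))

section
variable {K A : Type*} [Field K] [CommRing A] [Algebra K A]

/-- restriction to the line `X = α T + β` -/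
noncomputable def ls (α β : A) (f : MvPolynomial (Fin 2) K) : Polynomial A :=
  aeval ![Polynomial.X, Polynomial.C α * Polynomial.X + Polynomial.C β] f

lemma ls_eval (α β t : A) (f : MvPolynomial (Fin 2) K) :
    (ls α β f).eval t = aeval ![t, α * t + β] f := by
  have h : ((Polynomial.aeval t : Polynomial A →ₐ[A] A).restrictScalars K)
    (aeval ![Polynomial.X, Polynomial.C α * Polynomial.X + Polynomial.C β] f) =
      aeval ![t, α * t + β] f := by
    rw [comp_aeval_apply]
    congr 2
    funext i
    fin_cases i <;> simp
  exact h

lemma ls_map {B : Type*} [CommRing B] [Algebra K B] (φ : A →ₐ[K] B) (α β : A)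
    (f : MvPolynomial (Fin 2) K) :
    (ls α β f).map (φ : A →+* B) = ls (φ α) (φ β) f := by
  have h : (Polynomial.mapAlgHom φ)
    (aeval ![Polynomial.X, Polynomial.C α * Polynomial.X + Polynomial.C β] f) =
      ls (φ α) (φ β) f := by
    rw [comp_aeval_apply, ls]
    congr 2
    funext i
    fin_cases i <;> simp
  exact h

lemma ls_derivative (α β : A) (f : MvPolynomial (Fin 2) K) :
    (ls α β f).derivative = ls α β (pderiv 0 f) + Polynomial.C α * ls α β (pderiv 1 f) := by
  have h := deriv_aeval ((Polynomial.derivative' (R := A)).restrictScalars K)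
    ![Polynomial.X, Polynomial.C α * Polynomial.X + Polynomial.C β] f
  rw [Fin.sum_univ_two] at h
  have e : ∀ q : Polynomial A, ((Polynomial.derivative' (R := A)).restrictScalars K) q =
    Polynomial.derivative q := fun q => rfl
  rw [e, e, e] at h
  simp only [Matrix.cons_val_zero, Matrix.cons_val_one, Polynomial.derivative_X,
    Polynomial.derivative_add, Polynomial.derivative_C, Polynomial.derivative_C_mul, add_zero,
    smul_eq_mul, mul_one] at h
  rw [ls, h, ls, ls]; ring

lemma ls_coeff (α β : A) {F : MvPolynomial (Fin 3) K} {d : ℕ} (hF : F.IsHomogeneous d) :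
    (ls α β (dh K F)).natDegree ≤ d ∧ (ls α β (dh K F)).coeff d = aeval ![0, 1, α] F := by
  have e : ls α β (dh K F) =
      aeval ![1, Polynomial.X, Polynomial.C α * Polynomial.X + Polynomial.C β] F := by
    rw [ls, aeval_dh]; rfl
  rw [e]
  have hl : (Polynomial.C α * Polynomial.X + Polynomial.C β).natDegree ≤ 1 :=
    Polynomial.natDegree_linear_le
  have hmon : ∀ m ∈ F.support,
      (aeval ![1, Polynomial.X, Polynomial.C α * Polynomial.X + Polynomial.C β]
        (monomial m (coeff m F))).natDegree ≤ d ∧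
      (aeval ![1, Polynomial.X, Polynomial.C α * Polynomial.X + Polynomial.C β]
        (monomial m (coeff m F))).coeff d = aeval ![0, 1, α] (monomial m (coeff m F)) := by
    intro m hm
    have hd : m 0 + m 1 + m 2 = d := by
      have := hF (mem_support_iff.mp hm)
      rw [← this, Finsupp.weight_apply, Finsupp.sum_fintype _ _ (by simp), Fin.sum_univ_three]
      simp
    have hX : (Polynomial.X ^ m 1 : Polynomial A).natDegree ≤ m 1 := Polynomial.natDegree_X_pow_le _
    have hY : ((Polynomial.C α * Polynomial.X + Polynomial.C β) ^ m 2).natDegree ≤ m 2 := by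
      have := Polynomial.natDegree_pow_le_of_le (m 2) hl
      rwa [mul_one] at this
    have hXY := Polynomial.natDegree_mul_le_of_le hX hY
    rw [aeval_monomial, aeval_monomial, Finsupp.prod_fintype _ _ (by simp),
      Finsupp.prod_fintype _ _ (by simp), Fin.prod_univ_three,
      Fin.prod_univ_three]
    simp only [Matrix.cons_val_zero, Matrix.cons_val_one, Matrix.cons_val_two, Matrix.head_cons,
      Matrix.tail_cons, one_pow, one_mul, mul_one, Matrix.cons_val]
    have ec : algebraMap K (Polynomial A) (coeff m F) =
      Polynomial.C (algebraMap K A (coeff m F)) := rfl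
    rw [ec, Polynomial.coeff_C_mul]
    refine ⟨(Polynomial.natDegree_C_mul_le _ _).trans (by omega), ?_⟩
    congr 1
    rcases Nat.eq_zero_or_pos (m 0) with h | h
    · rw [h, pow_zero, one_mul]
      have hd' : d = m 1 + m 2 := by omega
      rw [hd', Polynomial.coeff_mul_add_eq_of_natDegree_le hX hY]
      have := Polynomial.coeff_pow_of_natDegree_le (m := m 2) hl
      rw [mul_one] at this
      rw [this]; simp
    · rw [zero_pow (by omega), zero_mul]
      exact Polynomial.coeff_eq_zero_of_natDegree_lt (by omega)
  have hsum := F.support_sum_monomial_coeff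
  constructor
  · rw [← hsum, map_sum]
    exact Polynomial.natDegree_sum_le_of_forall_le _ _ (fun m hm => (hmon m hm).1)
  · conv_lhs => rw [← hsum]
    conv_rhs => rw [← hsum]
    rw [map_sum, map_sum, Polynomial.finsetSum_coeff]
    exact Finset.sum_congr rfl (fun m hm => (hmon m hm).2)

end

lemma lead_ne {K k : Type*} [Field K] [Infinite K] [Field k] [Algebra K k]
    {F : MvPolynomial (Fin 3) K} {d : ℕ} (hF : F.IsHomogeneous d) {l : K}
    (hl : eval ![0, l, 1] F ≠ 0) {a : k} (ha : Transcendental K a) : aeval ![0, 1, a] F ≠ 0 := by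
  intro h
  let p : Polynomial K := aeval (![0, Polynomial.X, 1] : Fin 3 → Polynomial K) F
  have hp : ∀ r, p.eval r = eval ![0, r, 1] F := by
    intro r
    have : Polynomial.aeval r (aeval (![0, Polynomial.X, 1] : Fin 3 → Polynomial K) F) = aeval ![0, r, 1] F := by
      rw [comp_aeval_apply]
      congr 2
      funext i
      fin_cases i <;> simp
    exact this
  have hp0 : p * Polynomial.X ≠ 0 := by
    apply mul_ne_zero _ Polynomial.X_ne_zero
    intro h0
    rw [← hp, h0] at hl
    simp at hl
  have hex : ∃ r, (p * Polynomial.X).eval r ≠ 0 := by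
    by_contra hcon
    push Not at hcon
    exact hp0 (Polynomial.funext (by simpa using hcon))
  obtain ⟨r, hr⟩ := hex
  rw [Polynomial.eval_mul, Polynomial.eval_X, hp] at hr
  have hr0 : r ≠ 0 := right_ne_zero_of_mul hr
  let q : Polynomial K := aeval ![0, 1, Polynomial.X] F
  have hq : q = 0 := by
    by_contra hq0
    apply ha
    refine ⟨q, hq0, ?_⟩
    have : Polynomial.aeval a (aeval (![0, 1, Polynomial.X] : Fin 3 → Polynomial K) F) = aeval ![0, 1, a] F := by
      rw [comp_aeval_apply]
      congr 2
      funext i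
      fin_cases i <;> simp
    exact this.trans h
  have hq2 : eval ![0, 1, r⁻¹] F = 0 := by
    have : Polynomial.aeval r⁻¹ (aeval (![0, 1, Polynomial.X] : Fin 3 → Polynomial K) F) = aeval ![0, 1, r⁻¹] F := by
      rw [comp_aeval_apply]
      congr 2
      funext i
      fin_cases i <;> simp
    change aeval ![0, 1, r⁻¹] F = 0
    rw [← this]
    change Polynomial.aeval r⁻¹ q = 0
    rw [hq, map_zero]
  apply left_ne_zero_of_mul hr
  have hsc := hom_scale hF r ![0, 1, r⁻¹]
  rw [show aeval ![0, 1, r⁻¹] F = eval ![0, 1, r⁻¹] F from rfl, hq2, mul_zero] at hsc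
  refine Eq.trans ?_ hsc
  change aeval ![0, r, 1] F = _
  congr 2
  funext i
  fin_cases i <;> simp [hr0]

end GalLine

namespace GalLine
universe u

lemma indep_ab {K k : Type*} [Field K] [Field k] [Algebra K k] (a b : k)
    (ha : Transcendental K a) :
    AlgebraicIndependent K
      ![(PowerSeries.C a : PowerSeries k), PowerSeries.C b + PowerSeries.X] := by
  have h1 : Transcendental k (PowerSeries.C b + PowerSeries.X : PowerSeries k) := by
    rw [transcendental_iff]
    intro p hp
    have e : Polynomial.aeval (PowerSeries.C b + PowerSeries.X : PowerSeries k) p =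
      ((p.comp (Polynomial.C b + Polynomial.X) : Polynomial k) : PowerSeries k) := by
      have := Polynomial.aeval_algHom_apply (Polynomial.coeToPowerSeries.algHom k)
        (Polynomial.C b + Polynomial.X : Polynomial k) p
      have e2 : Polynomial.coeToPowerSeries.algHom (R := k) k (Polynomial.C b + Polynomial.X) =
        (PowerSeries.C b + PowerSeries.X : PowerSeries k) := by
        simp [Polynomial.coeToPowerSeries.algHom_apply]
      rw [e2] at this
      rw [this, Polynomial.coeToPowerSeries.algHom_apply]
      rfl
    rw [e] at hp
    have h0 : p.comp (Polynomial.C b + Polynomial.X) = 0 := by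
      exact_mod_cast hp
    have := congrArg (fun q => q.comp (Polynomial.X - Polynomial.C b)) h0
    simpa [Polynomial.comp_assoc] using this
  have h2 := (algebraicIndependent_unique_type_iff (R := K) (ι := Unit) (x := fun _ => a)).mpr ha
  have h3 := (algebraicIndependent_unique_type_iff (R := k) (ι := Unit)
    (x := fun _ => (PowerSeries.C b + PowerSeries.X : PowerSeries k))).mpr h1
  have h4 := h2.sumElim_comp h3
  have h5 := h4.comp (![Sum.inr (), Sum.inl ()] : Fin 2 → Unit ⊕ Unit) (by
    intro i j; fin_cases i <;> fin_cases j <;> simp)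
  convert! h5 using 1
  funext i
  fin_cases i <;> rfl

lemma main_transp {K : Type u} [Field K] [IsAlgClosed K] {f : MvPolynomial (Fin 2) K} {d : ℕ}
    (hf : Good f d) {L : Type u} [Field L] [Algebra (MvPolynomial (Fin 2) K) L]
    [IsFractionRing (MvPolynomial (Fin 2) K) L] [Algebra K L]
    [IsScalarTower K (MvPolynomial (Fin 2) K) L]
    (g : Polynomial L) (hg : g = ls (algebraMap (MvPolynomial (Fin 2) K) L (X 0))
      (algebraMap (MvPolynomial (Fin 2) K) L (X 1)) f) :
    g.Separable ∧ g.natDegree = d ∧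
    ∃ (τ : g.SplittingField ≃ₐ[L] g.SplittingField) (x y : g.SplittingField), x ≠ y ∧
      x ∈ g.rootSet g.SplittingField ∧ y ∈ g.rootSet g.SplittingField ∧ τ x = y ∧ τ y = x ∧
      ∀ z ∈ g.rootSet g.SplittingField, z ≠ x → z ≠ y → τ z = z := by
  have : Infinite K := IsAlgClosed.instInfinite
  obtain ⟨k, _, _, _, P, a, hP, ha, hbit⟩ := no_bitangent hf
  have hta := slope_transc hf hP ha
  set b := P 1 - a * P 0 with hb
  have hPP : (![P 0, a * P 0 + b] : Fin 2 → k) = P := by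
    funext i; fin_cases i <;> simp [hb]
  let R := PowerSeries k
  let E := FractionRing R
  let N := AlgebraicClosure E
  let α : R := PowerSeries.C a
  let β : R := PowerSeries.C b + PowerSeries.X
  let G : Polynomial R := ls α β f
  let cc : R →ₐ[K] k := { (PowerSeries.constantCoeff (R := k)) with
    commutes' := fun r => by
      change PowerSeries.constantCoeff (algebraMap K (PowerSeries k) r) = _
      simp [PowerSeries.algebraMap_apply] }
  let ci : k →ₐ[K] R := { (PowerSeries.C (R := k)) with
    commutes' := fun r => (PowerSeries.algebraMap_apply (R := K) (A := k) (r := r)).symm }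
  have hG0 : G.map PowerSeries.constantCoeff = ls a b f := by
    have := ls_map cc α β f
    have e1 : cc α = a := PowerSeries.constantCoeff_C a
    have e2 : cc β = b := by
      change PowerSeries.constantCoeff (PowerSeries.C b + PowerSeries.X) = b
      simp
    rw [e1, e2] at this
    exact this
  obtain ⟨F, hF, hFf, l, hl⟩ := hf.lead
  have hF0 : aeval ![0, 1, a] F ≠ 0 := lead_ne hF hl hta
  have hlc := ls_coeff α β hF
  rw [hFf] at hlc
  have hlc2 : aeval ![0, 1, α] F = PowerSeries.C (aeval ![0, 1, a] F) := by
    have : ci (aeval ![0, 1, a] F) = aeval ![0, 1, α] F := by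
      rw [comp_aeval_apply]
      congr 2
      funext i
      fin_cases i
      · exact map_zero ci
      · exact map_one ci
      · rfl
    exact this.symm
  have hlc3 : IsUnit (G.coeff d) := by
    rw [hlc.2, hlc2, PowerSeries.isUnit_iff_constantCoeff, PowerSeries.constantCoeff_C]
    exact isUnit_iff_ne_zero.mpr hF0
  have hdeg : G.natDegree = d :=
    Polynomial.natDegree_eq_of_le_of_coeff_ne_zero hlc.1 hlc3.ne_zero
  have hder1 : (ls a b f).derivative = ls a b (pderiv 0 f) + Polynomial.C a * ls a b (pderiv 1 f) :=
    ls_derivative a b f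
  have h2k : (2 : k) ≠ 0 := by
    intro h
    apply hf.two
    apply (algebraMap K k).injective
    rw [map_ofNat, h, map_zero]
  have hloc := local_part (E := E) (N := N) h2k G (by rw [Polynomial.leadingCoeff, hdeg]; exact hlc3)
    (P 0)
    (by rw [hG0, ls_eval, hPP]; exact (hP f).mpr dvd_rfl)
    (by
      rw [hG0, hder1, Polynomial.eval_add, Polynomial.eval_mul, ls_eval, ls_eval, hPP,
        Polynomial.eval_C]
      exact ha)
    (by
      rw [hG0, hder1, Polynomial.derivative_add, Polynomial.derivative_C_mul, ls_derivative,
        ls_derivative]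
      simp only [Polynomial.eval_add, Polynomial.eval_mul, ls_eval, hPP, Polynomial.eval_C]
      have := sec_ne hf hP ha
      rw [pderiv_comm' f 1 0]
      intro h
      apply this
      rw [← h]; ring)
    (by
      intro r hr hrt
      rw [hG0, ls_eval] at hr
      rw [hG0, hder1, Polynomial.eval_add, Polynomial.eval_mul, ls_eval, ls_eval,
        Polynomial.eval_C]
      intro h
      apply hrt
      exact hbit _ hr h (by simp))
    (by
      rw [ls_eval]
      have hD := deriv_aeval ((PowerSeries.derivative k).restrictScalars K)
        ![PowerSeries.C (P 0), α * PowerSeries.C (P 0) + β] f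
      rw [Fin.sum_univ_two] at hD
      have e : ∀ q : PowerSeries k, ((PowerSeries.derivative k).restrictScalars K) q =
        PowerSeries.derivative k q := fun q => rfl
      rw [e, e, e] at hD
      have e1 : PowerSeries.derivative k (α * PowerSeries.C (P 0) + β) = 1 := by
        simp only [α, β, map_add, ← map_mul, PowerSeries.derivative_C, PowerSeries.derivative_X,
          zero_add]
      simp only [Matrix.cons_val_zero, Matrix.cons_val_one, PowerSeries.derivative_C, e1,
        smul_eq_mul, mul_one, mul_zero, zero_add] at hD
      have h1 := congrArg (PowerSeries.coeff 0) hD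
      rw [PowerSeries.coeff_derivative] at h1
      simp only [Nat.cast_zero, zero_add, mul_one] at h1
      rw [h1, PowerSeries.coeff_zero_eq_constantCoeff]
      have h2 : cc (aeval ![PowerSeries.C (P 0), α * PowerSeries.C (P 0) + β] (pderiv 1 f)) =
          aeval P (pderiv 1 f) := by
        rw [comp_aeval_apply]
        congr 2
        funext i
        fin_cases i
        · exact PowerSeries.constantCoeff_C _
        · change PowerSeries.constantCoeff (PowerSeries.C a * PowerSeries.C (P 0) +
            (PowerSeries.C b + PowerSeries.X)) = P 1
          simp [hb]
      intro h
      exact fX_ne hf hP (h2.symm.trans h))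
  obtain ⟨hsep, σ, x, y, hxy, hx, hy, hsx, hsy, hsz⟩ := hloc
  have hind := indep_ab (K := K) a b hta
  let φ : MvPolynomial (Fin 2) K →ₐ[K] E :=
    (IsScalarTower.toAlgHom K R E).comp (aeval ![α, β])
  have hφ : Function.Injective φ := (IsFractionRing.injective R E).comp hind
  let ψ : L →ₐ[K] E := IsFractionRing.liftAlgHom hφ
  have hψ : ∀ q, ψ (algebraMap _ L q) = φ q := fun q => IsFractionRing.lift_algebraMap hφ q
  let _ : Algebra L E := ψ.toRingHom.toAlgebra
  have hgE : g.map (algebraMap L E) = G.map (algebraMap R E) := by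
    have h1 := ls_map ψ (algebraMap (MvPolynomial (Fin 2) K) L (X 0))
      (algebraMap (MvPolynomial (Fin 2) K) L (X 1)) f
    have h2 := ls_map (IsScalarTower.toAlgHom K R E) α β f
    rw [hψ, hψ] at h1
    have e0 : φ (X 0) = IsScalarTower.toAlgHom K R E α := by simp [φ]
    have e1 : φ (X 1) = IsScalarTower.toAlgHom K R E β := by simp [φ]
    rw [e0, e1, ← h2, ← hg] at h1
    exact h1
  have hae : ∀ z : N, Polynomial.aeval z (G.map (algebraMap R E)) = Polynomial.aeval z g := by
    intro z
    rw [← hgE, Polynomial.aeval_map_algebraMap]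
  replace hx := (hae x).symm.trans hx
  replace hy := (hae y).symm.trans hy
  replace hsz : ∀ z : N, Polynomial.aeval z g = 0 → z ≠ x → z ≠ y → σ z = z :=
    fun z hz => hsz z ((hae z).trans hz)
  rw [← hgE, Polynomial.separable_map] at hsep
  refine ⟨hsep, ?_, transp_transfer g hsep.ne_zero σ x y hxy hx hy hsx hsy hsz⟩
  rw [← hdeg, ← Polynomial.natDegree_map_eq_of_injective (IsFractionRing.injective R E) G, ← hgE,
    Polynomial.natDegree_map]

end GalLine

namespace GalLine
universe u

lemma exists_conj {L M W : Type*} [Field L] [Field M] [Field W] [Algebra L M] [Algebra L W]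
    [Normal L W] (j j' : M →ₐ[L] W) : ∃ τ : W ≃ₐ[L] W, ∀ m, τ (j m) = j' m := by
  let _ : Algebra M W := j.toRingHom.toAlgebra
  have : IsScalarTower L M W := IsScalarTower.of_algebraMap_eq fun x => (j.commutes x).symm
  let σ : W →ₐ[L] W := AlgHom.liftNormal j' W
  refine ⟨AlgEquiv.ofBijective σ (AlgHom.normal_bijective L W W σ), fun m => ?_⟩
  exact AlgHom.liftNormal_commutes j' W m

lemma trdeg_two {K A S : Type u} [Field K] [CommRing A] [CommRing S] [IsDomain S] [Algebra K A]
    [Algebra K S] (il ir : A →ₐ[K] S) (hil : Function.Injective il) (hir : Function.Injective ir)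
    (u : A) (hu : ∀ y : A, IsAlgebraic (Algebra.adjoin K {u}) y)
    (hind : ∀ p : S → Prop, p 0 → (∀ a b, p a → p b → p (a + b)) → (∀ a b, p (il a * ir b)) →
      ∀ z, p z) : Algebra.trdeg K S ≤ (2 : ℕ) := by
  let s : Set S := {il u, ir u}
  let V := Algebra.adjoin K s
  have key : ∀ i : A →ₐ[K] S, Function.Injective i → i u ∈ s →
      ∀ y, IsAlgebraic V (i y) := by
    intro i hi hus y
    have hmem : ∀ x : Algebra.adjoin K {u}, i (x : A) ∈ V := by
      intro x
      have : Algebra.adjoin K {u} ≤ V.comap i := by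
        apply Algebra.adjoin_le
        rintro _ rfl
        exact Algebra.subset_adjoin hus
      exact this x.2
    let i0 : Algebra.adjoin K {u} →ₐ[K] V :=
      (i.comp (Algebra.adjoin K {u}).val).codRestrict V hmem
    refine IsAlgebraic.ringHom_of_comp_eq (i0 : _ →+* V) (i : _ →+* S) (hu y) ?_ ?_
    · intro a b hab
      exact Subtype.ext (hi (congrArg Subtype.val hab))
    · rfl
  have hl := key il hil (Or.inl rfl)
  have hr := key ir hir (Or.inr rfl)
  have hV : Algebra.IsAlgebraic V S := by
    constructor
    exact hind _ isAlgebraic_zero (fun a b ha hb => ha.add hb) (fun a b => (hl a).mul (hr b))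
  have := Algebra.IsAlgebraic.trdeg_le_cardinalMk K s
  refine this.trans ?_
  refine (Cardinal.mk_insert_le).trans ?_
  rw [Cardinal.mk_singleton]
  norm_num

open TensorProduct in
lemma tens_pack {K : Type u} [Field K] [IsAlgClosed K] {f : MvPolynomial (Fin 2) K}
    (hf : Irreducible f) : ∃ (S : Type u) (_ : CommRing S) (_ : IsDomain S) (_ : Algebra K S)
      (il ir : AA f →ₐ[K] S), Algebra.trdeg K S ≤ (2 : ℕ) ∧
      ∀ (E : Type u) [Field E] [Algebra K E] (φ ψ : AA f →ₐ[K] E), ∃ χ : S →ₐ[K] E,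
        χ.comp il = φ ∧ χ.comp ir = ψ := by
  have := AA_domain hf
  have hD : IsDomain (AA f ⊗[K] AA f) := tensor_domain
  obtain ⟨u, hu⟩ := AA_alg hf
  let il : AA f →ₐ[K] AA f ⊗[K] AA f := Algebra.TensorProduct.includeLeft
  let ir : AA f →ₐ[K] AA f ⊗[K] AA f := Algebra.TensorProduct.includeRight
  refine ⟨AA f ⊗[K] AA f, inferInstance, hD, inferInstance, il, ir, ?_, ?_⟩
  · refine trdeg_two il ir (Algebra.TensorProduct.includeLeft_injective (S := K)
      (algebraMap K (AA f)).injective) (Algebra.TensorProduct.includeRight_injective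
      (algebraMap K (AA f)).injective) u hu ?_
    intro p h0 hadd hmul z
    induction z using TensorProduct.induction_on with
    | zero => exact h0
    | tmul a b =>
      have : a ⊗ₜ[K] b = il a * ir b := by simp [il, ir]
      rw [this]
      exact hmul a b
    | add a b ha hb => exact hadd _ _ ha hb
  · intro E _ _ φ ψ
    refine ⟨Algebra.TensorProduct.productMap φ ψ, ?_, ?_⟩
    · ext x; simp [il]
    · ext x; simp [ir]

lemma isAlg_lin {R E : Type*} [CommRing R] [Field E] [Algebra R E] (c e : R) (y : E)
    (hc : algebraMap R E c ≠ 0) (h : algebraMap R E c * y = algebraMap R E e) :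
    IsAlgebraic R y := by
  refine ⟨Polynomial.C c * Polynomial.X - Polynomial.C e, ?_, ?_⟩
  · intro h0
    have := congrArg (fun q => Polynomial.coeff q 1) h0
    simp [Polynomial.coeff_C] at this
    exact hc (by rw [this, map_zero])
  · simp [h]

lemma two_trans {K : Type u} [Field K] [IsAlgClosed K] {f : MvPolynomial (Fin 2) K}
    (hf : Irreducible f) {L : Type u} [Field L] [Algebra (MvPolynomial (Fin 2) K) L]
    [IsFractionRing (MvPolynomial (Fin 2) K) L] [Algebra K L]
    [IsScalarTower K (MvPolynomial (Fin 2) K) L]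
    {W : Type u} [Field W] [Algebra L W] [Normal L W]
    (g : Polynomial L) (hg : g = ls (algebraMap (MvPolynomial (Fin 2) K) L (X 0))
      (algebraMap (MvPolynomial (Fin 2) K) L (X 1)) f)
    (t₁ t₂ s₁ s₂ : W) (ht : t₁ ≠ t₂) (hs : s₁ ≠ s₂)
    (ht₁ : t₁ ∈ g.rootSet W) (ht₂ : t₂ ∈ g.rootSet W)
    (hs₁ : s₁ ∈ g.rootSet W) (hs₂ : s₂ ∈ g.rootSet W) :
    ∃ τ : W ≃ₐ[L] W, τ t₁ = s₁ ∧ τ t₂ = s₂ := by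
  obtain ⟨S, _, _, _, il, ir, htr, hlift⟩ := tens_pack hf
  let _ : Algebra K W := ((algebraMap L W).comp (algebraMap K L)).toAlgebra
  have : IsScalarTower K L W := IsScalarTower.of_algebraMap_eq fun x => rfl
  let iW : MvPolynomial (Fin 2) K →ₐ[K] W :=
    (IsScalarTower.toAlgHom K L W).comp (IsScalarTower.toAlgHom K (MvPolynomial (Fin 2) K) L)
  have hiW : Function.Injective iW :=
    (algebraMap L W).injective.comp (IsFractionRing.injective (MvPolynomial (Fin 2) K) L)
  let a : W := iW (X 0)
  let b : W := iW (X 1)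
  have hroot : ∀ t ∈ g.rootSet W, aeval ![t, a * t + b] f = 0 := by
    intro t ht
    have h1 := Polynomial.aeval_eq_zero_of_mem_rootSet ht
    rw [Polynomial.aeval_def, Polynomial.eval₂_eq_eval_map, hg] at h1
    have h2 := ls_map (IsScalarTower.toAlgHom K L W) (algebraMap (MvPolynomial (Fin 2) K) L (X 0))
      (algebraMap (MvPolynomial (Fin 2) K) L (X 1)) f
    rw [← ls_eval, ← h1]
    exact congrArg (Polynomial.eval t) h2.symm
  have hab : AlgebraicIndependent K ![a, b] := by
    have : (![a, b] : Fin 2 → W) = iW ∘ X := by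
      funext i; fin_cases i <;> rfl
    rw [this]
    exact (MvPolynomial.algebraicIndependent_X (Fin 2) K).map' hiW
  let P₁ : Fin 2 → S := fun i => il (pt f i)
  let P₂ : Fin 2 → S := fun i => ir (pt f i)
  have key : ∀ (t t' : W), t ≠ t' → t ∈ g.rootSet W → t' ∈ g.rootSet W →
      ∃ φ : S →ₐ[K] W, Function.Injective φ ∧ φ (P₁ 0) = t ∧ φ (P₁ 1) = a * t + b ∧
        φ (P₂ 0) = t' ∧ φ (P₂ 1) = a * t' + b := by
    intro t t' hne h h'
    obtain ⟨φ, h1, h2⟩ := hlift W (ptHom _ (hroot t h)) (ptHom _ (hroot t' h'))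
    have e1 : ∀ i, φ (P₁ i) = (![t, a * t + b] : Fin 2 → W) i := fun i =>
      (DFunLike.congr_fun h1 (pt f i)).trans (ptHom_pt _ _ i)
    have e2 : ∀ i, φ (P₂ i) = (![t', a * t' + b] : Fin 2 → W) i := fun i =>
      (DFunLike.congr_fun h2 (pt f i)).trans (ptHom_pt _ _ i)
    have e10 : φ (P₁ 0) = t := e1 0
    have e11 : φ (P₁ 1) = a * t + b := e1 1
    have e20 : φ (P₂ 0) = t' := e2 0
    have e21 : φ (P₂ 1) = a * t' + b := e2 1
    refine ⟨φ, ?_, e10, e11, e20, e21⟩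
    refine inj_of_indep 2 htr φ _ hab ?_
    have hc : algebraMap φ.range W ⟨φ (P₁ 0 - P₂ 0), ⟨_, rfl⟩⟩ ≠ 0 := by
      change φ (P₁ 0 - P₂ 0) ≠ 0
      rw [map_sub, e10, e20]
      exact sub_ne_zero.mpr hne
    intro i
    fin_cases i
    · refine isAlg_lin _ ⟨φ (P₁ 1 - P₂ 1), ⟨_, rfl⟩⟩ _ hc ?_
      change φ (P₁ 0 - P₂ 0) * a = φ (P₁ 1 - P₂ 1)
      simp only [map_sub, e10, e20, e11, e21]; ring
    · refine isAlg_lin _ ⟨φ (P₁ 0 * P₂ 1 - P₂ 0 * P₁ 1), ⟨_, rfl⟩⟩ _ hc ?_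
      change φ (P₁ 0 - P₂ 0) * b = φ (P₁ 0 * P₂ 1 - P₂ 0 * P₁ 1)
      simp only [map_sub, map_mul, e10, e20, e11, e21]; ring
  let M := FractionRing S
  let R₁ : Fin 2 → M := fun i => algebraMap S M (P₁ i)
  let R₂ : Fin 2 → M := fun i => algebraMap S M (P₂ i)
  let aM : M := (R₁ 1 - R₂ 1) / (R₁ 0 - R₂ 0)
  let bM : M := R₁ 1 - aM * R₁ 0
  have key2 : ∀ (t t' : W), t ≠ t' → t ∈ g.rootSet W → t' ∈ g.rootSet W →
      ∃ j : M →ₐ[K] W, j (R₁ 0) = t ∧ j (R₂ 0) = t' ∧ j aM = a ∧ j bM = b := by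
    intro t t' hne h h'
    obtain ⟨φ, hinj, e10, e11, e20, e21⟩ := key t t' hne h h'
    let j : M →ₐ[K] W := IsFractionRing.liftAlgHom hinj
    have hj : ∀ x, j (algebraMap S M x) = φ x := fun x => IsFractionRing.lift_algebraMap hinj x
    have j10 : j (R₁ 0) = t := (hj _).trans e10
    have j20 : j (R₂ 0) = t' := (hj _).trans e20
    have j11 : j (R₁ 1) = a * t + b := (hj _).trans e11
    have j21 : j (R₂ 1) = a * t' + b := (hj _).trans e21
    have hne' := sub_ne_zero.mpr hne
    have ja : j aM = a := by
      simp only [aM, map_div₀, map_sub, j10, j20, j11, j21]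
      rw [div_eq_iff hne']; ring
    refine ⟨j, j10, j20, ja, ?_⟩
    simp only [bM, map_sub, map_mul, ja, j11, j10]; ring
  obtain ⟨j, j1, j2, ja, jb⟩ := key2 t₁ t₂ ht ht₁ ht₂
  obtain ⟨j', j1', j2', ja', jb'⟩ := key2 s₁ s₂ hs hs₁ hs₂
  let h : MvPolynomial (Fin 2) K →ₐ[K] M := aeval ![aM, bM]
  have hh : ∀ i : M →ₐ[K] W, i aM = a → i bM = b → i.comp h = iW := by
    intro i ia ib
    apply MvPolynomial.algHom_ext
    intro n
    fin_cases n
    · simpa [h] using ia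
    · simpa [h] using ib
  have hjh := hh j ja jb
  have hinj : Function.Injective h := by
    have : Function.Injective (j.comp h) := by rw [hjh]; exact hiW
    exact Function.Injective.of_comp this
  let _ : Algebra L M := (IsFractionRing.lift (A := MvPolynomial (Fin 2) K) (K := L)
    (g := (h : _ →+* M)) hinj).toAlgebra
  have hcomm : ∀ i : M →ₐ[K] W, i.comp h = iW →
      (i : M →+* W).comp (algebraMap L M) = algebraMap L W := by
    intro i hi
    apply IsLocalization.ringHom_ext (nonZeroDivisors (MvPolynomial (Fin 2) K))
    refine RingHom.ext fun x => ?_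
    have e1 : algebraMap L M (algebraMap (MvPolynomial (Fin 2) K) L x) = h x :=
      IsFractionRing.lift_algebraMap (A := MvPolynomial (Fin 2) K) (K := L) hinj x
    have e2 := DFunLike.congr_fun hi x
    change i (algebraMap L M (algebraMap (MvPolynomial (Fin 2) K) L x)) = _
    rw [e1]
    exact e2
  let J : M →ₐ[L] W := ⟨j, fun x => DFunLike.congr_fun (hcomm j hjh) x⟩
  let J' : M →ₐ[L] W := ⟨j', fun x => DFunLike.congr_fun (hcomm j' (hh j' ja' jb')) x⟩
  obtain ⟨τ, hτ⟩ := exists_conj J J'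
  refine ⟨τ, ?_, ?_⟩
  · have := hτ (R₁ 0)
    change τ (j (R₁ 0)) = j' (R₁ 0) at this
    rwa [j1, j1'] at this
  · have := hτ (R₂ 0)
    change τ (j (R₂ 0)) = j' (R₂ 0) at this
    rwa [j2, j2'] at this

end GalLine

namespace GalLine
universe u

lemma all_perms {L W : Type*} [Field L] [Field W] [Algebra L W] (g : Polynomial L)
    (h2 : ∀ t₁ ∈ g.rootSet W, ∀ t₂ ∈ g.rootSet W, ∀ s₁ ∈ g.rootSet W, ∀ s₂ ∈ g.rootSet W,
      t₁ ≠ t₂ → s₁ ≠ s₂ → ∃ τ : W ≃ₐ[L] W, τ t₁ = s₁ ∧ τ t₂ = s₂)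
    (τ : W ≃ₐ[L] W) (x y : W) (hxy : x ≠ y) (hx : x ∈ g.rootSet W) (hy : y ∈ g.rootSet W)
    (hτx : τ x = y) (hτy : τ y = x) (hτ : ∀ z ∈ g.rootSet W, z ≠ x → z ≠ y → τ z = z)
    (σ : Equiv.Perm (g.rootSet W)) : ∃ ρ : W ≃ₐ[L] W, ∀ z : g.rootSet W, ρ z = σ z := by
  classical
  let H : Subgroup (Equiv.Perm (g.rootSet W)) :=
    { carrier := {σ | ∃ ρ : W ≃ₐ[L] W, ∀ z : g.rootSet W, ρ z = σ z}
      one_mem' := ⟨1, fun z => rfl⟩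
      mul_mem' := by
        rintro a b ⟨ρ, hρ⟩ ⟨ρ', hρ'⟩
        refine ⟨ρ * ρ', fun z => ?_⟩
        rw [AlgEquiv.mul_apply, hρ', hρ]; rfl
      inv_mem' := by
        rintro a ⟨ρ, hρ⟩
        refine ⟨ρ.symm, fun z => ?_⟩
        rw [AlgEquiv.symm_apply_eq, hρ]
        exact congrArg Subtype.val (a.apply_symm_apply z).symm }
  have hstab : ∀ (ρ : W ≃ₐ[L] W) (z : W), z ∈ g.rootSet W → ρ z ∈ g.rootSet W := by
    intro ρ z hz
    rw [Polynomial.mem_rootSet] at hz ⊢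
    refine ⟨hz.1, ?_⟩
    have := Polynomial.aeval_algHom_apply (ρ : W →ₐ[L] W) z g
    rw [hz.2, map_zero] at this
    exact this
  have hH : H = ⊤ := by
    rw [eq_top_iff, ← Equiv.Perm.closure_isSwap, Subgroup.closure_le]
    rintro _ ⟨a, b, hab, rfl⟩
    obtain ⟨ρ, ha, hb⟩ := h2 x hx y hy a a.2 b b.2 hxy (fun h => hab (Subtype.ext h))
    refine ⟨(ρ.symm.trans τ).trans ρ, fun z => ?_⟩
    change ρ (τ (ρ.symm z)) = _
    have hmem := hstab ρ.symm z z.2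
    by_cases hza : z = a
    · subst hza
      rw [Equiv.swap_apply_left, ← ha, AlgEquiv.symm_apply_apply, hτx, hb]
    by_cases hzb : z = b
    · subst hzb
      rw [Equiv.swap_apply_right, ← hb, AlgEquiv.symm_apply_apply, hτy, ha]
    rw [Equiv.swap_apply_of_ne_of_ne hza hzb, hτ _ hmem, AlgEquiv.apply_symm_apply]
    · intro h
      exact hza (Subtype.ext (by rw [← ha, ← h, AlgEquiv.apply_symm_apply]))
    · intro h
      exact hzb (Subtype.ext (by rw [← hb, ← h, AlgEquiv.apply_symm_apply]))
  have : σ ∈ H := hH ▸ Subgroup.mem_top σ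
  exact this

lemma closed_case {K : Type u} [Field K] [IsAlgClosed K] {f : MvPolynomial (Fin 2) K} {d : ℕ}
    (hf : Good f d) {L : Type u} [Field L] [Algebra (MvPolynomial (Fin 2) K) L]
    [IsFractionRing (MvPolynomial (Fin 2) K) L] [Algebra K L]
    [IsScalarTower K (MvPolynomial (Fin 2) K) L]
    (g : Polynomial L) (hg : g = ls (algebraMap (MvPolynomial (Fin 2) K) L (X 0))
      (algebraMap (MvPolynomial (Fin 2) K) L (X 1)) f) :
    g.Separable ∧ g.natDegree = d ∧ ∀ σ : Equiv.Perm (g.rootSet g.SplittingField),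
      ∃ ρ : g.SplittingField ≃ₐ[L] g.SplittingField, ∀ z : g.rootSet g.SplittingField,
        ρ z = σ z := by
  obtain ⟨h1, h2, τ, x, y, hxy, hx, hy, hτx, hτy, hτ⟩ := main_transp hf g hg
  refine ⟨h1, h2, ?_⟩
  have : Normal L g.SplittingField := Normal.of_isSplittingField g
  refine all_perms g ?_ τ x y hxy hx hy hτx hτy hτ
  intro t₁ ht₁ t₂ ht₂ s₁ hs₁ s₂ hs₂ ht hs
  exact two_trans hf.irr g hg t₁ t₂ s₁ s₂ ht hs ht₁ ht₂ hs₁ hs₂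

lemma gal_transfer {L L' W : Type*} [Field L] [Field L'] [Field W] [Algebra L L'] [Algebra L' W]
    (h : Polynomial L) (g : Polynomial L') (hg : h.map (algebraMap L L') = g)
    (hs : (g.map (algebraMap L' W)).Splits) (hsep : g.Separable) (d : ℕ) (hd : g.natDegree = d)
    (hall : ∀ σ : Equiv.Perm (g.rootSet W),
      ∃ ρ : W ≃ₐ[L'] W, ∀ z : g.rootSet W, ρ z = σ z) :
    Nonempty (h.Gal ≃* Equiv.Perm (Fin d)) := by
  let _ : Algebra L W := ((algebraMap L' W).comp (algebraMap L L')).toAlgebra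
  have : IsScalarTower L L' W := IsScalarTower.of_algebraMap_eq fun x => rfl
  have hmap : h.map (algebraMap L W) = g.map (algebraMap L' W) := by
    rw [← hg, Polynomial.map_map]; rfl
  have : Fact ((h.map (algebraMap L W)).Splits) := ⟨by rw [hmap]; exact hs⟩
  classical
  have hroot : h.rootSet W = g.rootSet W := by
    rw [Polynomial.rootSet_def, Polynomial.rootSet_def, Polynomial.aroots, Polynomial.aroots, hmap]
  have hsurj : Function.Surjective (Polynomial.Gal.galActionHom h W) := by
    intro σ
    have e : h.rootSet W ≃ g.rootSet W := Equiv.setCongr hroot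
    obtain ⟨ρ, hρ⟩ := hall ((Equiv.setCongr hroot).permCongr σ)
    refine ⟨Polynomial.Gal.restrict h W (ρ.restrictScalars L), ?_⟩
    ext z
    rw [Polynomial.Gal.galActionHom_restrict]
    exact hρ (Equiv.setCongr hroot z)
  have hbij : Function.Bijective (Polynomial.Gal.galActionHom h W) :=
    ⟨Polynomial.Gal.galActionHom_injective h W, hsurj⟩
  have hcard : Fintype.card (g.rootSet W) = d := by
    rw [Polynomial.card_rootSet_eq_natDegree hsep hs, hd]
  let e : h.rootSet W ≃ Fin d := (Equiv.setCongr hroot).trans (Fintype.equivFinOfCardEq hcard)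
  exact ⟨(MulEquiv.ofBijective _ hbij).trans (Equiv.permCongrHom e)⟩

theorem final {K : Type u} [Field K] (p : ℕ) [CharP K p]
    (f : MvPolynomial (Fin 2) K) (d : ℕ) (hd2 : 2 ≤ d)
    (hdeg : f.totalDegree = d)
    (hp : ¬ (p ∣ d * (d - 1)))
    (hirr : Irreducible (MvPolynomial.map (algebraMap K (AlgebraicClosure K)) f))
    (F : MvPolynomial (Fin 3) K) (hF : F.IsHomogeneous d)
    (hFf : MvPolynomial.aeval ![1, MvPolynomial.X 0, MvPolynomial.X 1] F = f)
    (hsm : ∀ x : Fin 3 → AlgebraicClosure K, x ≠ 0 →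
    MvPolynomial.eval x (F.map (algebraMap K (AlgebraicClosure K))) = 0 →
    ∃ j : Fin 3, MvPolynomial.eval x ((MvPolynomial.pderiv j F).map
      (algebraMap K (AlgebraicClosure K))) ≠ 0)
    (h : Polynomial (FractionRing (MvPolynomial (Fin 2) K)))
    (hh : h = ls (algebraMap (MvPolynomial (Fin 2) K) (FractionRing (MvPolynomial (Fin 2) K)) (X 0))
      (algebraMap (MvPolynomial (Fin 2) K) (FractionRing (MvPolynomial (Fin 2) K)) (X 1)) f) :
    Nonempty (h.Gal ≃* Equiv.Perm (Fin d)) := by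
  let k := AlgebraicClosure K
  let ι : K →+* k := algebraMap K k
  let F' := F.map ι
  have hdh : dh k F' = f.map ι := by
    have : (dh k : MvPolynomial (Fin 3) k →+* MvPolynomial (Fin 2) k).comp (MvPolynomial.map ι) =
        (MvPolynomial.map ι).comp (dh K : MvPolynomial (Fin 3) K →+* MvPolynomial (Fin 2) K) := by
      apply MvPolynomial.ringHom_ext
      · intro r; simp [dh]
      · intro i; fin_cases i <;> simp [dh]
    have e := DFunLike.congr_fun this F
    change dh k F' = MvPolynomial.map ι (dh K F) at e
    rw [e, ← hFf]; rfl
  have hcast : ∀ n : ℕ, (n : k) = 0 → p ∣ n := by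
    intro n hn
    rw [← CharP.cast_eq_zero_iff K p]
    apply ι.injective
    rw [map_natCast, map_zero, hn]
  have hgood : Good (f.map ι) d := by
    rw [← hdh]
    refine good_of (hF.map ι) ?_ ?_ hd2 ?_ ?_ ?_
    · rw [hdh, ← hdeg]
      simp only [MvPolynomial.totalDegree, MvPolynomial.support_map_of_injective _ ι.injective]
    · rw [hdh]; exact hirr
    · exact fun h0 => hp ((hcast _ h0).mul_right _)
    · exact fun h0 => hp ((hcast _ h0).mul_left _)
    · intro x hx h0
      obtain ⟨j, hj⟩ := hsm x hx h0
      refine ⟨j, ?_⟩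
      rw [pderiv_map]
      exact hj
  let L := FractionRing (MvPolynomial (Fin 2) K)
  let L' := FractionRing (MvPolynomial (Fin 2) k)
  let m : MvPolynomial (Fin 2) K →+* L' :=
    (algebraMap (MvPolynomial (Fin 2) k) L').comp (MvPolynomial.map ι)
  have hm : Function.Injective m :=
    (IsFractionRing.injective (MvPolynomial (Fin 2) k) L').comp
      (MvPolynomial.map_injective ι ι.injective)
  let _ : Algebra L L' := (IsFractionRing.lift hm).toAlgebra
  have hLL : ∀ q : MvPolynomial (Fin 2) K, algebraMap L L' (algebraMap _ L q) =
      algebraMap _ L' (MvPolynomial.map ι q) := fun q => IsFractionRing.lift_algebraMap hm q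
  let g : Polynomial L' := ls (algebraMap (MvPolynomial (Fin 2) k) L' (X 0))
      (algebraMap (MvPolynomial (Fin 2) k) L' (X 1)) (f.map ι)
  have hg : h.map (algebraMap L L') = g := by
    rw [hh]
    have : (Polynomial.mapRingHom (algebraMap L L')).comp
        ((aeval ![Polynomial.X, Polynomial.C (algebraMap (MvPolynomial (Fin 2) K) L (X 0)) *
          Polynomial.X + Polynomial.C (algebraMap (MvPolynomial (Fin 2) K) L (X 1))] :
          MvPolynomial (Fin 2) K →ₐ[K] Polynomial L) : MvPolynomial (Fin 2) K →+* Polynomial L) =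
        ((aeval ![Polynomial.X, Polynomial.C (algebraMap (MvPolynomial (Fin 2) k) L' (X 0)) *
          Polynomial.X + Polynomial.C (algebraMap (MvPolynomial (Fin 2) k) L' (X 1))] :
          MvPolynomial (Fin 2) k →ₐ[k] Polynomial L') : MvPolynomial (Fin 2) k →+* Polynomial L').comp
          (MvPolynomial.map ι) := by
      apply MvPolynomial.ringHom_ext
      · intro r
        have h1 := hLL (C r)
        rw [map_C] at h1
        simp only [RingHom.coe_comp, Function.comp_apply, RingHom.coe_coe, algHom_C, map_C]
        change Polynomial.map (algebraMap L L') (Polynomial.C (algebraMap K L r)) =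
          Polynomial.C (algebraMap k L' (ι r))
        rw [Polynomial.map_C]
        rw [IsScalarTower.algebraMap_apply K (MvPolynomial (Fin 2) K) L,
          IsScalarTower.algebraMap_apply k (MvPolynomial (Fin 2) k) L']
        exact congrArg Polynomial.C h1
      · intro i
        have h0 := hLL (X 0)
        have h1 := hLL (X 1)
        rw [map_X] at h0 h1
        fin_cases i
        · simp
        · simp [h0, h1]
    exact DFunLike.congr_fun this f
  obtain ⟨c1, c2, c3⟩ := closed_case hgood g rfl
  exact gal_transfer h g hg (Polynomial.SplittingField.splits g) c1 d c2 c3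

end GalLine

/-- if `K` is a field of characteristic `p` and `f ∈ K[T,X]` is
absolutely irreducible of total degree `d ≥ 2` with `p ∤ d(d − 1)` and smooth
homogenization, then the Galois group of (the splitting field of) `f(T, A·T + B)`
over `K(A,B)` is isomorphic to the full symmetric group `S_d`. -/
theorem gal_lineSubAB_eq_symmGroup (K : Type*) [Field K] (p : ℕ) [CharP K p]
    (f : MvPolynomial (Fin 2) K) (d : ℕ) (hd2 : 2 ≤ d)
    (hdeg : f.totalDegree = d)
    (hp : ¬ (p ∣ d * (d - 1)))
    (hirr : AbsolutelyIrreducible f)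
    (hsm : ∃ F : MvPolynomial (Fin 3) K, IsSmoothHomogenization F f d) :
    Nonempty ((lineSubAB f).Gal ≃* Equiv.Perm (Fin d)) := by
  obtain ⟨F, hF, hFf, hs⟩ := hsm
  exact GalLine.final p f d hd2 hdeg hp hirr F hF hFf hs (lineSubAB f) rfl
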